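/- Let S be a compact, orientable, two-dimensional embedded C^∞ submanifold of ℝ³ without boundary. There exist constants c > 0 and h₀ ∈ (0,1), depending only on S and γ₀ (in particular independent of z₀ and h), such that for every z₀ ∈ S and every admissible quasi-uniform triangulation T_h with h ≤ h₀ the following holds. Let z̃₀ = (a|_{S_h})⁻¹(z₀), let Ω₁ ⊂ S_h be the union of all triangles τ ∈ T_h with dist(z̃₀, τ) ≥ h, and Ω₁^S = a(Ω₁) ⊂ S. Let l̃_I ∈ V_h be a function equal to l̃ at all vertices of triangles contained in Ω₁ (vertices lie on S), and let l̄_I be its lift to S. Then ∫_{Ω₁^S} (l̄_I − l̃)² ≤ c h² and ∫_{Ω₁^S} r^{-2} |∇_S( r² (l̄_I − l̃) )|² ≤ c h² |log h|. -/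

import Mathlib

open MeasureTheory Metric
open scoped RealInnerProductSpace ENNReal NNReal

noncomputable section

/-- Ambient Euclidean space `ℝ³`. -/
abbrev E3 : Type := EuclideanSpace ℝ (Fin 3)

/-- The tangential gradient of `w : E3 → ℝ` along the set `A` at `x`, with values projected
onto the subspace `P`: the orthogonal projection onto `P` of the Riesz representative of the
derivative of `w` within `A` at `x`. -/
def tGrad (A : Set E3) (P : Submodule ℝ E3) (w : E3 → ℝ) (x : E3) : E3 :=
  (Submodule.orthogonalProjectionOnto P ((InnerProductSpace.toDual ℝ E3).symm (fderivWithin ℝ w A x)) : E3)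

/-- A compact, orientable, two-dimensional embedded `C^∞` submanifold of `ℝ³` without boundary,
described by a global smooth unit normal field `n` and local smooth regular defining functions. -/
structure SmoothSurface where
  S : Set E3
  n : E3 → E3
  compact : IsCompact S
  nonempty : S.Nonempty
  localLevel : ∀ x ∈ S, ∃ U : Set E3, ∃ F : E3 → ℝ, IsOpen U ∧ x ∈ U ∧
    ContDiff ℝ (⊤ : ℕ∞) F ∧ S ∩ U = {y ∈ U | F y = 0} ∧
    (∀ y ∈ U, gradient F y ≠ 0) ∧
    (∀ y, y ∈ S ∩ U → ∃ t : ℝ, gradient F y = t • n y)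
  n_unit : ∀ x ∈ S, ‖n x‖ = 1
  n_smooth : ∃ U : Set E3, IsOpen U ∧ S ⊆ U ∧ ContDiffOn ℝ (⊤ : ℕ∞) n U

namespace SmoothSurface

variable (Srf : SmoothSurface)

/-- The tangent plane of `S` at `x`, as the orthogonal complement of the normal. -/
def tangent (x : E3) : Submodule ℝ E3 := (ℝ ∙ Srf.n x)ᗮ

/-- The tangential gradient `∇_S w` on the surface. -/
def grad (w : E3 → ℝ) (x : E3) : E3 := tGrad Srf.S (Srf.tangent x) w x

/-- The bilinear form `a(v,w) = ∫_S (⟨∇_S v, ∇_S w⟩ + v w)` (w.r.t. 2-dimensional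
Hausdorff measure on `S`). -/
def aForm (v w : E3 → ℝ) : ℝ :=
  ∫ x in Srf.S, (⟪Srf.grad v x, Srf.grad w x⟫ + v x * w x) ∂μH[2]

end SmoothSurface

/-- The (closed, flat) triangle with vertices `t.1, t.2.1, t.2.2`. -/
def triOf (t : E3 × E3 × E3) : Set E3 := convexHull ℝ {t.1, t.2.1, t.2.2}

/-- The vertex set of a triangle. -/
def vertsOf (t : E3 × E3 × E3) : Set E3 := {t.1, t.2.1, t.2.2}

/-- The plane spanned by a triangle. -/
def planeOf (t : E3 × E3 × E3) : Set E3 := (affineSpan ℝ (vertsOf t) : Set E3)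

/-- The direction (2-dimensional linear subspace) of the plane of a triangle. -/
def dirOf (t : E3 × E3 × E3) : Submodule ℝ E3 := (affineSpan ℝ (vertsOf t)).direction

/-- The triangle-wise tangential gradient `∇_{S_h} w` on the triangle `t`. -/
def gradTri (t : E3 × E3 × E3) (w : E3 → ℝ) (x : E3) : E3 := tGrad (triOf t) (dirOf t) w x

/-- An admissible quasi-uniform triangulation `T_h` of the surface `Srf` with mesh parameter `h`
and quasi-uniformity constant `γ₀`, together with the nearest-point projection `a` defined on
a tubular neighbourhood `N` of the surface. -/
structure Triangulation (Srf : SmoothSurface) (γ₀ h : ℝ) where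
  T : Finset (E3 × E3 × E3)
  a : E3 → E3
  N : Set E3
  T_nonempty : T.Nonempty
  indep : ∀ t ∈ T, AffineIndependent ℝ ![t.1, t.2.1, t.2.2]
  verts_on : ∀ t ∈ T, vertsOf t ⊆ Srf.S
  meet : ∀ t ∈ T, ∀ t' ∈ T, t ≠ t' →
    triOf t ∩ triOf t' = ∅ ∨
    (∃ v, v ∈ vertsOf t ∩ vertsOf t' ∧ triOf t ∩ triOf t' = {v}) ∨
    (∃ v w, v ≠ w ∧ v ∈ vertsOf t ∩ vertsOf t' ∧ w ∈ vertsOf t ∩ vertsOf t' ∧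
      triOf t ∩ triOf t' = segment ℝ v w)
  diam_le : ∀ t ∈ T, Metric.diam (triOf t) ≤ h
  disk : ∀ t ∈ T, ∃ y ∈ triOf t, closedBall y (γ₀ * h) ∩ planeOf t ⊆ triOf t
  N_open : IsOpen N
  S_sub : Srf.S ⊆ N
  Sh_sub : (⋃ t ∈ T, triOf t) ⊆ N
  a_smooth : ContDiffOn ℝ (⊤ : ℕ∞) a N
  a_mem : ∀ x ∈ N, a x ∈ Srf.S
  a_nearest : ∀ x ∈ N, ∀ y ∈ Srf.S, dist x (a x) ≤ dist x y
  a_unique : ∀ x ∈ N, ∀ y ∈ Srf.S, dist x y = dist x (a x) → y = a x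
  a_bij : Set.BijOn a (⋃ t ∈ T, triOf t) Srf.S

namespace Triangulation

variable {Srf : SmoothSurface} {γ₀ h : ℝ} (Tr : Triangulation Srf γ₀ h)

/-- The polyhedral surface `S_h`, the union of the triangles. -/
def Sh : Set E3 := ⋃ t ∈ Tr.T, triOf t

/-- Membership in the finite element space `V_h` of continuous, piecewise affine functions
on `S_h` (as functions `E3 → ℝ`; only the values on `S_h` are relevant). -/
def IsVh (v : E3 → ℝ) : Prop :=
  ContinuousOn v Tr.Sh ∧
  ∀ t ∈ Tr.T, ∃ (L : E3 →ₗ[ℝ] ℝ) (c : ℝ), ∀ x ∈ triOf t, v x = L x + c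


/-- The discrete bilinear form
`a_h(v,w) = ∫_{S_h} (⟨∇_{S_h} v, ∇_{S_h} w⟩ + v w)`, computed triangle by triangle. -/
def ahForm (v w : E3 → ℝ) : ℝ :=
  ∑ t ∈ Tr.T, ∫ x in triOf t,
    (⟪gradTri t v x, gradTri t w x⟫ + v x * w x) ∂μH[2]

/-- The lift of a function on `S_h` to a function on `S` via the inverse of `a|_{S_h}`. -/
def liftS (w : E3 → ℝ) : E3 → ℝ := fun y => w (Function.invFunOn Tr.a Tr.Sh y)

/-- The lift of `f : S → ℝ` to `S_h` is `f ∘ a`. -/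
def liftSh (f : E3 → ℝ) : E3 → ℝ := fun x => f (Tr.a x)

end Triangulation

/-- `f` is smooth in a neighbourhood of the set `A`. -/
def SmoothNear (f : E3 → ℝ) (A : Set E3) : Prop :=
  ∃ V : Set E3, IsOpen V ∧ A ⊆ V ∧ ContDiffOn ℝ (⊤ : ℕ∞) f V

/-- `u` is the (weak, hence smooth) solution of `-Δ_S u + u = f` on the surface `Srf`. -/
def IsSolution (Srf : SmoothSurface) (f u : E3 → ℝ) : Prop :=
  SmoothNear u Srf.S ∧
  ∀ φ : E3 → ℝ, ContDiff ℝ (⊤ : ℕ∞) φ → Srf.aForm u φ = ∫ x in Srf.S, f x * φ x ∂μH[2]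

/-- `uh` is the discrete Galerkin solution in `V_h` with data the lift `f ∘ a` of `f`. -/
def Triangulation.IsDiscreteSolution {Srf : SmoothSurface} {γ₀ h : ℝ}
    (Tr : Triangulation Srf γ₀ h) (f uh : E3 → ℝ) : Prop :=
  Tr.IsVh uh ∧
  ∀ φh : E3 → ℝ, Tr.IsVh φh →
    Tr.ahForm uh φh = ∫ x in Tr.Sh, f (Tr.a x) * φh x ∂μH[2]

/-- Orthogonal projection onto the affine tangent plane of `S` at `z₀`. -/
def SmoothSurface.P0 (Srf : SmoothSurface) (z₀ : E3) (x : E3) : E3 :=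
  z₀ + (Submodule.orthogonalProjectionOnto (Srf.tangent z₀) (x - z₀) : E3)

/-- `r(x) = ‖P₀(x) − z₀‖`, the distance of the tangential projection of `x` to `z₀`. -/
def SmoothSurface.rfn (Srf : SmoothSurface) (z₀ : E3) (x : E3) : ℝ :=
  ‖Srf.P0 z₀ x - z₀‖

/-- The affine tangent plane `z₀ + T_{z₀}S`. -/
def SmoothSurface.tplane (Srf : SmoothSurface) (z₀ : E3) : Set E3 :=
  {x : E3 | x - z₀ ∈ Srf.tangent z₀}

/-- The disk `D = B₁₀₀(z₀)` in the affine tangent plane at `z₀`. -/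
def SmoothSurface.disk100 (Srf : SmoothSurface) (z₀ : E3) : Set E3 :=
  Srf.tplane z₀ ∩ closedBall z₀ 100

/-- `r₁ > 0` is a graph radius for `S`: uniformly in `z₀ ∈ S`, the piece `B_{2r₁}(z₀) ∩ S`
is a graph over the tangent plane at `z₀`, in particular `P₀` is injective on it. -/
def SmoothSurface.IsGraphRadius (Srf : SmoothSurface) (r₁ : ℝ) : Prop :=
  0 < r₁ ∧ r₁ ≤ 1 ∧ ∀ z₀ ∈ Srf.S, Set.InjOn (Srf.P0 z₀) (Srf.S ∩ closedBall z₀ (2 * r₁))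

/-- `ζ` is an admissible smooth cutoff at `z₀`: supported in the ball of radius `3r₁/2`,
equal to `1` on the ball of radius `r₁`, with `C²`-bounds at most `Cζ` (uniform in `z₀`). -/
def IsCutoff (z₀ : E3) (r₁ Cζ : ℝ) (ζ : E3 → ℝ) : Prop :=
  ContDiff ℝ (⊤ : ℕ∞) ζ ∧ tsupport ζ ⊆ closedBall z₀ (3 / 2 * r₁) ∧
  (∀ x ∈ closedBall z₀ r₁, ζ x = 1) ∧
  ∀ x : E3, |ζ x| + ‖fderiv ℝ ζ x‖ + ‖fderiv ℝ (fderiv ℝ ζ) x‖ ≤ Cζ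

/-- `v` is the Neumann Green's function with pole `z₀` of `−Δ + 1` on the disk
`D = B₁₀₀(z₀)` in the tangent plane at `z₀`: it is smooth away from the pole, satisfies
`∫_D (⟨∇v, ∇φ⟩ + v φ) = φ(z₀)` for every smooth test function, and differs from
`(1/2π) log‖· − z₀‖` by an `H²(D)`-function with norm at most `CG`. -/
def SmoothSurface.IsGreen (Srf : SmoothSurface) (z₀ : E3) (CG : ℝ) (v : E3 → ℝ) : Prop :=
  ContDiffOn ℝ (⊤ : ℕ∞) v (Srf.disk100 z₀ \ {z₀}) ∧
  (∀ φ : E3 → ℝ, ContDiff ℝ (⊤ : ℕ∞) φ →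
    ∫ x in Srf.disk100 z₀,
      (⟪tGrad (Srf.disk100 z₀) (Srf.tangent z₀) v x,
        tGrad (Srf.disk100 z₀) (Srf.tangent z₀) φ x⟫ + v x * φ x) ∂μH[2] = φ z₀) ∧
  (∫ x in Srf.disk100 z₀,
      ((v x - (1 / (2 * Real.pi)) * Real.log ‖x - z₀‖) ^ 2 +
        ‖fderivWithin ℝ (fun y => v y - (1 / (2 * Real.pi)) * Real.log ‖y - z₀‖)
            (Srf.disk100 z₀) x‖ ^ 2 +
        ‖fderivWithin ℝ
            (fun y => fderivWithin ℝ
              (fun y' => v y' - (1 / (2 * Real.pi)) * Real.log ‖y' - z₀‖)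
              (Srf.disk100 z₀) y)
            (Srf.disk100 z₀) x‖ ^ 2) ∂μH[2]) ≤ CG

/-- The approximate Green's function `g̃(x) = ζ(x) v(P₀(x))` on `S`. -/
def approxGreen (Srf : SmoothSurface) (z₀ : E3) (ζ v : E3 → ℝ) : E3 → ℝ :=
  fun x => ζ x * v (Srf.P0 z₀ x)

/-- The cut-off lifted logarithm `l̃(x) = ζ(x) log r(x)` on `S`. -/
def cutLog (Srf : SmoothSurface) (z₀ : E3) (ζ : E3 → ℝ) : E3 → ℝ :=
  fun x => ζ x * Real.log (Srf.rfn z₀ x)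

/-- `lh` is the discrete (Galerkin) projection of the function `w` on `S`:
`a_h(lh, v_h) = a(w, V_h)` for all `v_h ∈ V_h`, where `V_h` is the lift of `v_h` to `S`. -/
def Triangulation.IsDiscreteProjection {Srf : SmoothSurface} {γ₀ h : ℝ}
    (Tr : Triangulation Srf γ₀ h) (w lh : E3 → ℝ) : Prop :=
  Tr.IsVh lh ∧ ∀ vh : E3 → ℝ, Tr.IsVh vh → Tr.ahForm lh vh = Srf.aForm w (Tr.liftS vh)




/-! ### Geometry of the surface -/

/-- Local second order estimate of a smooth function. -/
lemma local_taylor (F : E3 → ℝ) (hF : ContDiff ℝ (⊤ : ℕ∞) F) (x : E3) :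
    ∃ K : ℝ, 0 ≤ K ∧ ∃ ε > 0, ∀ y ∈ ball x ε, ∀ y' ∈ ball x ε,
      |F y' - F y - fderiv ℝ F y (y' - y)| ≤ K * ‖y' - y‖ ^ 2 := by
  have h1 : ContDiffAt ℝ 1 (fderiv ℝ F) x := by
    have : ContDiff ℝ 1 (fderiv ℝ F) := hF.fderiv_right (m := 1) (by norm_cast)
    exact this.contDiffAt
  obtain ⟨K, t, ht, hK⟩ := h1.exists_lipschitzOnWith
  obtain ⟨ε, hε, hb⟩ := Metric.mem_nhds_iff.1 ht
  refine ⟨K, K.2, ε, hε, fun y hy y' hy' => ?_⟩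
  have hseg : segment ℝ y y' ⊆ ball x ε := (convex_ball x ε).segment_subset hy hy'
  have hdiff : Differentiable ℝ F := hF.differentiable (by simp)
  have := (convex_segment y y').norm_image_sub_le_of_norm_hasFDerivWithin_le'
    (f := F) (f' := fderiv ℝ F) (φ := fderiv ℝ F y) (C := K * ‖y' - y‖)
    (fun z _ => (hdiff z).hasFDerivAt.hasFDerivWithinAt)
    (fun z hz => by
      have h2 := hK.dist_le_mul z (hb (hseg hz)) y (hb hy)
      rw [dist_eq_norm, dist_eq_norm] at h2
      refine h2.trans ?_
      gcongr
      rw [← dist_eq_norm, ← dist_eq_norm]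
      have := mem_segment_iff_wbtw.1 hz
      have h3 := this.dist_add_dist
      rw [dist_comm z y, dist_comm y' y]
      linarith [dist_nonneg (x := z) (y := y')])
    (left_mem_segment ℝ y y') (right_mem_segment ℝ y y')
  rw [Real.norm_eq_abs] at this
  calc _ ≤ _ := this
    _ = _ := by ring

lemma quad_normal_local (Srf : SmoothSurface) (x : E3) (hx : x ∈ Srf.S) :
    ∃ C : ℝ, 0 ≤ C ∧ ∃ ε > 0, ∀ y ∈ Srf.S ∩ ball x ε, ∀ y' ∈ Srf.S ∩ ball x ε,
      |⟪Srf.n y, y' - y⟫| ≤ C * ‖y' - y‖ ^ 2 := by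
  obtain ⟨U, F, hU, hxU, hF, hSU, hg, hn⟩ := Srf.localLevel x hx
  obtain ⟨K, hK0, ε, hε, hK⟩ := local_taylor F hF x
  have hdiff : Differentiable ℝ F := hF.differentiable (by simp)
  have hcont : Continuous (fderiv ℝ F) := hF.continuous_fderiv (by simp)
  have hgn : ∀ y, ‖gradient F y‖ = ‖fderiv ℝ F y‖ := fun y => by simp [gradient]
  have hpos : 0 < ‖fderiv ℝ F x‖ := by
    rw [← hgn]; exact norm_pos_iff.2 (hg x hxU)
  set m := ‖fderiv ℝ F x‖ / 2 with hm
  have hmpos : 0 < m := by positivity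
  have hev : {y | m < ‖fderiv ℝ F y‖} ∈ nhds x :=
    (isOpen_lt continuous_const hcont.norm).mem_nhds (by simp only [Set.mem_ofPred_eq]; linarith)
  obtain ⟨ε', hε', hb⟩ := Metric.mem_nhds_iff.1 (Filter.inter_mem hev (hU.mem_nhds hxU))
  refine ⟨K / m, by positivity, min ε ε', lt_min hε hε', ?_⟩
  rintro y ⟨hyS, hy⟩ y' ⟨hyS', hy'⟩
  have hyb := hb (ball_subset_ball (min_le_right _ _) hy)
  have hyb' := hb (ball_subset_ball (min_le_right _ _) hy')
  have h1 := hK y (ball_subset_ball (min_le_left _ _) hy) y' (ball_subset_ball (min_le_left _ _) hy')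
  have hF0 : ∀ q ∈ Srf.S ∩ U, F q = 0 := fun q hq => by
    rw [hSU] at hq; exact hq.2
  rw [hF0 y ⟨hyS, hyb.2⟩, hF0 y' ⟨hyS', hyb'.2⟩] at h1
  obtain ⟨t, ht⟩ := hn y ⟨hyS, hyb.2⟩
  have h2 : fderiv ℝ F y (y' - y) = t * ⟪Srf.n y, y' - y⟫ := by
    have : fderiv ℝ F y (y' - y) = ⟪gradient F y, y' - y⟫ := by
      simp [gradient]
    rw [this, ht, real_inner_smul_left]
  have h3 : m < |t| := by
    have := hyb.1
    simp only [Set.mem_ofPred_eq] at this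
    rw [← hgn, ht, norm_smul, Srf.n_unit y hyS, mul_one] at this
    exact this
  rw [h2, sub_zero, zero_sub, abs_neg, abs_mul] at h1
  rw [div_mul_eq_mul_div, le_div_iff₀ hmpos]
  calc _ ≤ |⟪Srf.n y, y' - y⟫| * |t| := by gcongr
    _ ≤ _ := by rw [mul_comm]; exact h1

/-- `|⟨y' - y, n(y)⟩| ≤ C |y' - y|²` on a compact smooth surface. -/
lemma quad_normal (Srf : SmoothSurface) : ∃ C : ℝ, 1 ≤ C ∧ ∀ y ∈ Srf.S, ∀ y' ∈ Srf.S,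
    |⟪Srf.n y, y' - y⟫| ≤ C * ‖y' - y‖ ^ 2 := by
  have hcomp : IsCompact (Srf.S ×ˢ Srf.S) := Srf.compact.prod Srf.compact
  have key : ∃ C : ℝ, 1 ≤ C ∧ ∀ p ∈ Srf.S ×ˢ Srf.S, p.1 ∈ Srf.S → p.2 ∈ Srf.S →
      |⟪Srf.n p.1, p.2 - p.1⟫| ≤ C * ‖p.2 - p.1‖ ^ 2 := by
    refine hcomp.induction_on (p := fun s => ∃ C : ℝ, 1 ≤ C ∧ ∀ p ∈ s, p.1 ∈ Srf.S → p.2 ∈ Srf.S →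
      |⟪Srf.n p.1, p.2 - p.1⟫| ≤ C * ‖p.2 - p.1‖ ^ 2) ⟨1, le_rfl, by simp⟩ ?_ ?_ ?_
    · rintro s t hst ⟨C, hC, h⟩
      exact ⟨C, hC, fun p hp => h p (hst hp)⟩
    · rintro s t ⟨C, hC, h⟩ ⟨C', hC', h'⟩
      refine ⟨max C C', le_max_of_le_left hC, ?_⟩
      rintro p (hp | hp) h1 h2
      · refine (h p hp h1 h2).trans ?_
        gcongr; exact le_max_left _ _
      · refine (h' p hp h1 h2).trans ?_
        gcongr; exact le_max_right _ _
    · rintro ⟨p, q⟩ ⟨hp, hq⟩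
      simp only at hp hq
      by_cases hpq : p = q
      · subst hpq
        obtain ⟨C, hC, ε, hε, h⟩ := quad_normal_local Srf p hp
        refine ⟨ball p ε ×ˢ ball p ε, mem_nhdsWithin_of_mem_nhds
          (prod_mem_nhds (ball_mem_nhds p hε) (ball_mem_nhds p hε)), max C 1, le_max_right _ _, ?_⟩
        rintro ⟨y, y'⟩ ⟨hy, hy'⟩ h1 h2
        refine (h y ⟨h1, hy⟩ y' ⟨h2, hy'⟩).trans ?_
        gcongr; exact le_max_left _ _
      · have hd : 0 < ‖q - p‖ := norm_pos_iff.2 (sub_ne_zero.2 (Ne.symm hpq))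
        have hev : {z : E3 × E3 | ‖q - p‖ / 2 < ‖z.2 - z.1‖} ∈ nhds (p, q) :=
          (isOpen_lt continuous_const (continuous_snd.sub continuous_fst).norm).mem_nhds
            (show ‖q - p‖ / 2 < ‖q - p‖ by linarith)
        refine ⟨_, mem_nhdsWithin_of_mem_nhds hev, max (2 / ‖q - p‖) 1, le_max_right _ _, ?_⟩
        rintro ⟨y, y'⟩ hy h1 h2
        simp only [Set.mem_ofPred_eq] at hy h1 h2 ⊢
        have h3 : |⟪Srf.n y, y' - y⟫| ≤ ‖y' - y‖ := by
          have := abs_real_inner_le_norm (Srf.n y) (y' - y)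
          rwa [Srf.n_unit y h1, one_mul] at this
        have h4 : 1 ≤ 2 / ‖q - p‖ * ‖y' - y‖ := by
          rw [div_mul_eq_mul_div, le_div_iff₀ hd]; linarith
        calc _ ≤ 1 * ‖y' - y‖ := by rw [one_mul]; exact h3
          _ ≤ (2 / ‖q - p‖ * ‖y' - y‖) * ‖y' - y‖ := by gcongr
          _ = 2 / ‖q - p‖ * ‖y' - y‖ ^ 2 := by ring
          _ ≤ _ := by gcongr; exact le_max_left _ _
  obtain ⟨C, hC, h⟩ := key
  exact ⟨C, hC, fun y hy y' hy' => h (y, y') ⟨hy, hy'⟩ hy hy'⟩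

lemma n_diff (Srf : SmoothSurface) (y : E3) (hy : y ∈ Srf.S) : DifferentiableAt ℝ Srf.n y := by
  obtain ⟨U, hU, hSU, hn⟩ := Srf.n_smooth
  exact (hn.contDiffAt (hU.mem_nhds (hSU hy))).differentiableAt (by simp)

lemma n_cont (Srf : SmoothSurface) : ContinuousOn Srf.n Srf.S := fun y hy =>
  (n_diff Srf y hy).continuousAt.continuousWithinAt

lemma n_deriv_bound (Srf : SmoothSurface) : ∃ C : ℝ, 1 ≤ C ∧ ∀ y ∈ Srf.S,
    ‖fderiv ℝ Srf.n y‖ ≤ C := by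
  obtain ⟨U, hU, hSU, hn⟩ := Srf.n_smooth
  have hc : ContinuousOn (fderiv ℝ Srf.n) Srf.S :=
    (hn.continuousOn_fderiv_of_isOpen hU (by simp)).mono hSU
  obtain ⟨C, hC⟩ := Srf.compact.exists_bound_of_continuousOn hc
  exact ⟨max C 1, le_max_right _ _, fun y hy => (hC y hy).trans (le_max_left _ _)⟩

/-- Projection orthogonal to a vector `n` (used for unit vectors). -/
def prj (n : E3) : E3 →L[ℝ] E3 := ContinuousLinearMap.id ℝ E3 - (innerSL ℝ n).smulRight n

lemma prj_apply (n v : E3) : prj n v = v - ⟪n, v⟫ • n := by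
  simp [prj]

lemma proj_eq (n v : E3) (hn : ‖n‖ = 1) :
    ((Submodule.orthogonalProjectionOnto (ℝ ∙ n)ᗮ v : (ℝ ∙ n)ᗮ) : E3) = prj n v := by
  rw [prj_apply, ← Submodule.starProjection_apply, Submodule.starProjection_orthogonal_val,
    Submodule.starProjection_unit_singleton ℝ hn]

lemma prj_norm_sq (n v : E3) (hn : ‖n‖ = 1) : ‖prj n v‖ ^ 2 = ‖v‖ ^ 2 - ⟪n, v⟫ ^ 2 := by
  rw [prj_apply, norm_sub_sq_real, real_inner_smul_right, norm_smul, hn, real_inner_comm,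
    mul_one, Real.norm_eq_abs, sq_abs]
  ring

lemma prj_norm_le (n v : E3) (hn : ‖n‖ = 1) : ‖prj n v‖ ≤ ‖v‖ := by
  have := prj_norm_sq n v hn
  have h2 := sq_nonneg ⟪n, v⟫
  exact abs_le_of_sq_le_sq' (by linarith) (norm_nonneg _) |>.2

lemma prj_inner (n v w : E3) (hn : ‖n‖ = 1) : ⟪prj n v, prj n w⟫ = ⟪prj n v, w⟫ := by
  have : ⟪n, n⟫ = (1 : ℝ) := by rw [real_inner_self_eq_norm_sq, hn]; norm_num
  simp only [prj_apply, inner_sub_left, inner_sub_right, real_inner_smul_left,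
    real_inner_smul_right, this]
  rw [real_inner_comm n v]
  ring

lemma rfn_eq (Srf : SmoothSurface) (z x : E3) (hz : z ∈ Srf.S) :
    Srf.rfn z x = ‖prj (Srf.n z) (x - z)‖ := by
  rw [SmoothSurface.rfn, SmoothSurface.P0, add_sub_cancel_left]
  exact congrArg norm (proj_eq _ _ (Srf.n_unit z hz))

lemma rfn_le (Srf : SmoothSurface) (z x : E3) (hz : z ∈ Srf.S) : Srf.rfn z x ≤ ‖x - z‖ := by
  rw [rfn_eq _ _ _ hz]; exact prj_norm_le _ _ (Srf.n_unit z hz)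

lemma rfn_lip (Srf : SmoothSurface) (z x y : E3) (hz : z ∈ Srf.S) :
    Srf.rfn z x ≤ Srf.rfn z y + ‖x - y‖ := by
  rw [rfn_eq _ _ _ hz, rfn_eq _ _ _ hz]
  have : x - z = (y - z) + (x - y) := by abel
  rw [this, map_add]
  exact (norm_add_le _ _).trans (by gcongr; exact prj_norm_le _ _ (Srf.n_unit z hz))

lemma rfn_lower (Srf : SmoothSurface) (r₁ : ℝ) (hr₁ : Srf.IsGraphRadius r₁) :
    ∃ c : ℝ, 0 < c ∧ c ≤ 1 ∧ ∀ z ∈ Srf.S, ∀ x ∈ Srf.S, ‖x - z‖ ≤ 2 * r₁ →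
      c * ‖x - z‖ ≤ Srf.rfn z x := by
  obtain ⟨C, hC1, hC⟩ := quad_normal Srf
  obtain ⟨hr0, hr1, hinj⟩ := hr₁
  set δ := 1 / (2 * C) with hδ
  have hδ0 : 0 < δ := by positivity
  have near : ∀ z ∈ Srf.S, ∀ x ∈ Srf.S, ‖x - z‖ ≤ δ → 1 / 2 * ‖x - z‖ ≤ Srf.rfn z x := by
    intro z hz x hx hxz
    rw [rfn_eq _ _ _ hz]
    have h1 := hC z hz x hx
    have h2 := prj_norm_sq (Srf.n z) (x - z) (Srf.n_unit z hz)
    have h3 : C * ‖x - z‖ ^ 2 ≤ 1 / 2 * ‖x - z‖ := by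
      have : C * ‖x - z‖ ≤ 1 / 2 := by
        calc C * ‖x - z‖ ≤ C * δ := by gcongr
          _ = 1 / 2 := by rw [hδ]; field_simp
      nlinarith [norm_nonneg (x - z)]
    have h4 : ⟪Srf.n z, x - z⟫ ^ 2 ≤ (1 / 2 * ‖x - z‖) ^ 2 := by
      rw [← sq_abs]
      have := h1.trans h3
      gcongr
    refine abs_le_of_sq_le_sq' ?_ (norm_nonneg _) |>.2
    nlinarith [sq_nonneg ‖x - z‖]
  set K : Set (E3 × E3) := (Srf.S ×ˢ Srf.S) ∩ {p | δ ≤ ‖p.1 - p.2‖ ∧ ‖p.1 - p.2‖ ≤ 2 * r₁} with hK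
  have hKc : IsCompact K := by
    refine (Srf.compact.prod Srf.compact).inter_right ?_
    exact (isClosed_le continuous_const (continuous_fst.sub continuous_snd).norm).inter
      (isClosed_le (continuous_fst.sub continuous_snd).norm continuous_const)
  have hnc : ContinuousOn (fun p : E3 × E3 => Srf.n p.2) K :=
    (n_cont Srf).comp continuous_snd.continuousOn (fun p hp => hp.1.2)
  have hfc : ContinuousOn (fun p : E3 × E3 => ‖prj (Srf.n p.2) (p.1 - p.2)‖) K := by
    simp only [prj_apply]
    fun_prop
  have hpos : ∀ p ∈ K, 0 < ‖prj (Srf.n p.2) (p.1 - p.2)‖ := by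
    rintro ⟨x, z⟩ ⟨⟨hx, hz⟩, h1, h2⟩
    simp only at hx hz h1 h2 ⊢
    rw [← rfn_eq _ _ _ hz, SmoothSurface.rfn]
    rw [norm_pos_iff, sub_ne_zero]
    intro hP
    have hzz : Srf.P0 z z = z := by simp [SmoothSurface.P0]
    have := hinj z hz ⟨hx, by rw [mem_closedBall, dist_eq_norm]; exact h2⟩
      ⟨hz, by simp [hr0.le]⟩ (hP.trans hzz.symm)
    rw [this] at h1
    simp at h1
    linarith
  by_cases hKe : K.Nonempty
  · obtain ⟨p, hpK, hp⟩ := hKc.exists_isMinOn hKe hfc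
    set m := ‖prj (Srf.n p.2) (p.1 - p.2)‖ with hm
    have hm0 : 0 < m := hpos p hpK
    refine ⟨min (1 / 2) (m / (2 * r₁)), lt_min (by norm_num) (by positivity),
      (min_le_left _ _).trans (by norm_num), fun z hz x hx hxz => ?_⟩
    rcases le_total ‖x - z‖ δ with h | h
    · refine le_trans ?_ (near z hz x hx h)
      gcongr; exact min_le_left _ _
    · have h5 := hp (show (x, z) ∈ K from ⟨⟨hx, hz⟩, h, hxz⟩)
      simp only [Set.mem_ofPred_eq] at h5
      rw [← rfn_eq _ _ _ hz] at h5
      calc _ ≤ m / (2 * r₁) * (2 * r₁) := by gcongr; exact min_le_right _ _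
        _ = m := by field_simp
        _ ≤ _ := h5
  · refine ⟨1 / 2, by norm_num, by norm_num, fun z hz x hx hxz => ?_⟩
    rcases le_total ‖x - z‖ δ with h | h
    · exact near z hz x hx h
    · exact absurd ⟨(x, z), ⟨⟨hx, hz⟩, h, hxz⟩⟩ hKe

/-- The vector from the nearest point is normal. -/
lemma nearest_normal (Srf : SmoothSurface) (x y : E3) (hy : y ∈ Srf.S)
    (hmin : ∀ y' ∈ Srf.S, dist x y ≤ dist x y') : ∃ σ : ℝ, x - y = σ • Srf.n y := by
  obtain ⟨U, F, hU, hyU, hF, hSU, hg, hn⟩ := Srf.localLevel y hy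
  have hF0 : ∀ q ∈ Srf.S ∩ U, F q = 0 := fun q hq => by
    rw [hSU] at hq; exact hq.2
  have hstrict : HasStrictFDerivAt F (fderiv ℝ F y) y :=
    (hF.contDiffAt).hasStrictFDerivAt (by simp)
  have hφ : HasStrictFDerivAt (fun q : E3 => ‖q - x‖ ^ 2) (2 • innerSL ℝ (y - x)) y := by
    have h1 := (hasStrictFDerivAt_norm_sq (y - x))
    have h2 : HasStrictFDerivAt (fun q : E3 => q - x) (ContinuousLinearMap.id ℝ E3) y :=
      (hasStrictFDerivAt_id y).sub_const x
    have := h1.comp y h2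
    simpa using this
  have hext : IsLocalExtrOn (fun q : E3 => ‖q - x‖ ^ 2) {q | F q = F y} y := by
    left
    have : ∀ᶠ q in nhdsWithin y {q | F q = F y}, q ∈ U ∩ {q | F q = F y} :=
      Filter.inter_mem (mem_nhdsWithin_of_mem_nhds (hU.mem_nhds hyU)) self_mem_nhdsWithin
    filter_upwards [this] with q hq
    have hqS : q ∈ Srf.S := by
      have : q ∈ Srf.S ∩ U := by
        rw [hSU]; exact ⟨hq.1, by rw [← hF0 y ⟨hy, hyU⟩]; exact hq.2⟩
      exact this.1
    have := hmin q hqS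
    rw [dist_comm, dist_eq_norm, dist_comm, dist_eq_norm] at this
    gcongr
  obtain ⟨a, b, hab, heq⟩ := hext.exists_multipliers_of_hasStrictFDerivAt_1d hstrict hφ
  obtain ⟨t, ht⟩ := hn y ⟨hy, hyU⟩
  have hgr : ∀ v, fderiv ℝ F y v = ⟪gradient F y, v⟫ := fun v => by simp [gradient]
  have hvec : a • gradient F y + (2 * b) • (y - x) = 0 := by
    refine ext_inner_right ℝ fun v => ?_
    have := congrArg (fun T : E3 →L[ℝ] ℝ => T v) heq
    simp only [add_apply, smul_apply, hgr,
      innerSL_apply_apply, zero_apply, smul_eq_mul, nsmul_eq_mul] at this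
    rw [inner_add_left, real_inner_smul_left, real_inner_smul_left, inner_zero_left]
    push_cast at this
    linarith
  have hb : b ≠ 0 := by
    rintro rfl
    have ha : a ≠ 0 := by
      rintro rfl; exact hab rfl
    simp only [mul_zero, zero_smul, add_zero] at hvec
    exact hg y hyU ((smul_eq_zero.1 hvec).resolve_left ha)
  refine ⟨a * t / (2 * b), ?_⟩
  rw [ht] at hvec
  have h2 : (2 * b) • (x - y) = (a * t) • Srf.n y := by
    rw [mul_smul a t, ← sub_eq_zero, ← neg_eq_zero, ← hvec]
    module
  rw [div_eq_inv_mul, mul_smul, ← h2, smul_smul, inv_mul_cancel₀ (by positivity), one_smul]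



/-! ### Triangles and the projection `a` -/

lemma tri_bound (t : E3 × E3 × E3) (L : E3 →ₗ[ℝ] ℝ) (c B : ℝ)
    (hv : ∀ v ∈ vertsOf t, |L v + c| ≤ B) : ∀ p ∈ triOf t, |L p + c| ≤ B := by
  have hconv : Convex ℝ {p : E3 | |L p + c| ≤ B} := by
    intro p hp q hq a b ha hb hab
    simp only [Set.mem_ofPred_eq] at hp hq ⊢
    have : L (a • p + b • q) + c = a * (L p + c) + b * (L q + c) := by
      simp only [map_add, map_smul, smul_eq_mul]
      linear_combination (-c) * hab
    rw [this]
    calc _ ≤ |a * (L p + c)| + |b * (L q + c)| := abs_add_le _ _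
      _ = a * |L p + c| + b * |L q + c| := by rw [abs_mul, abs_mul, abs_of_nonneg ha, abs_of_nonneg hb]
      _ ≤ a * B + b * B := by gcongr
      _ = B := by rw [← add_mul, hab, one_mul]
  exact fun p hp => convexHull_min (s := vertsOf t) hv hconv hp

lemma vert_mem_tri (t : E3 × E3 × E3) (v : E3) (hv : v ∈ vertsOf t) : v ∈ triOf t :=
  subset_convexHull ℝ _ hv

lemma tri_compact (t : E3 × E3 × E3) : IsCompact (triOf t) := by
  have : (vertsOf t).Finite := by simp [vertsOf]
  exact this.isCompact_convexHull ℝ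

lemma tri_convex (t : E3 × E3 × E3) : Convex ℝ (triOf t) := convex_convexHull ℝ _

section TriSec

variable {Srf : SmoothSurface} {γ₀ h : ℝ} (Tr : Triangulation Srf γ₀ h)

lemma tri_dist (t : E3 × E3 × E3) (ht : t ∈ Tr.T) (x y : E3) (hx : x ∈ triOf t)
    (hy : y ∈ triOf t) : ‖x - y‖ ≤ h := by
  rw [← dist_eq_norm]
  exact (dist_le_diam_of_mem (tri_compact t).isBounded hx hy).trans (Tr.diam_le t ht)

lemma dir_bound (hγ : 0 < γ₀) (hh : 0 < h) (t : E3 × E3 × E3) (ht : t ∈ Tr.T) (L : E3 →ₗ[ℝ] ℝ)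
    (c B : ℝ) (hv : ∀ v ∈ vertsOf t, |L v + c| ≤ B) (d : E3) (hd : d ∈ dirOf t) :
    |L d| ≤ 2 * B / (γ₀ * h) * ‖d‖ := by
  obtain ⟨y, hy, hsub⟩ := Tr.disk t ht
  have hR : 0 < γ₀ * h := by positivity
  by_cases hd0 : d = 0
  · simp [hd0]
  have hdn : 0 < ‖d‖ := norm_pos_iff.2 hd0
  have hyp : y ∈ planeOf t := convexHull_subset_affineSpan _ hy
  set d' := (γ₀ * h / ‖d‖) • d with hd'
  have hmem : y + d' ∈ triOf t := by
    apply hsub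
    refine ⟨?_, ?_⟩
    · rw [mem_closedBall, dist_eq_norm, add_sub_cancel_left, hd', norm_smul, Real.norm_eq_abs,
        abs_of_pos (by positivity)]
      exact le_of_eq (by field_simp)
    · have h1 : d' ∈ dirOf t := Submodule.smul_mem _ _ hd
      have := AffineSubspace.vadd_mem_of_mem_direction h1 hyp
      rwa [vadd_eq_add, add_comm] at this
  have h1 := tri_bound t L c B hv _ hmem
  have h2 := tri_bound t L c B hv _ hy
  have h3 : L d' = (L (y + d') + c) - (L y + c) := by rw [map_add]; ring
  have h4 : |L d'| ≤ 2 * B := by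
    rw [h3]; refine (abs_sub _ _).trans ?_; linarith
  rw [hd', map_smul, smul_eq_mul, abs_mul, abs_of_pos (by positivity)] at h4
  rw [div_mul_eq_mul_div, le_div_iff₀ hR]
  rw [div_mul_eq_mul_div, div_le_iff₀ hdn] at h4
  linarith

lemma tri_sub_Sh (t : E3 × E3 × E3) (ht : t ∈ Tr.T) : triOf t ⊆ Tr.Sh :=
  Set.subset_biUnion_of_mem (u := fun t => triOf t) ht

lemma tri_sub_N (t : E3 × E3 × E3) (ht : t ∈ Tr.T) : triOf t ⊆ Tr.N :=
  (tri_sub_Sh Tr t ht).trans Tr.Sh_sub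

lemma a_fix (v : E3) (hv : v ∈ Srf.S) : Tr.a v = v :=
  (Tr.a_unique v (Tr.S_sub hv) v hv (le_antisymm (by simp) (Tr.a_nearest v (Tr.S_sub hv) v hv))).symm

lemma foot_h (t : E3 × E3 × E3) (ht : t ∈ Tr.T) (x : E3) (hx : x ∈ triOf t) :
    ‖x - Tr.a x‖ ≤ h := by
  have hv : t.1 ∈ vertsOf t := by simp [vertsOf]
  have h1 := Tr.a_nearest x (tri_sub_N Tr t ht hx) t.1 (Tr.verts_on t ht hv)
  rw [dist_eq_norm, dist_eq_norm] at h1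
  exact h1.trans (tri_dist Tr t ht _ _ hx (vert_mem_tri t _ hv))

lemma vert_normal {C₁ : ℝ} (hC1 : 1 ≤ C₁)
    (hC : ∀ y ∈ Srf.S, ∀ y' ∈ Srf.S, |⟪Srf.n y, y' - y⟫| ≤ C₁ * ‖y' - y‖ ^ 2)
    (t : E3 × E3 × E3) (ht : t ∈ Tr.T) (x : E3) (hx : x ∈ triOf t) :
    ∀ v ∈ vertsOf t, |(innerSL ℝ (Srf.n (Tr.a x)) : E3 →ₗ[ℝ] ℝ) v + -⟪Srf.n (Tr.a x), Tr.a x⟫|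
      ≤ 4 * C₁ * h ^ 2 := by
  intro v hv
  have h1 := hC _ (Tr.a_mem x (tri_sub_N Tr t ht hx)) v (Tr.verts_on t ht hv)
  have h2 : ‖v - Tr.a x‖ ≤ 2 * h := by
    have : v - Tr.a x = (v - x) + (x - Tr.a x) := by abel
    rw [this]
    refine (norm_add_le _ _).trans ?_
    linarith [foot_h Tr t ht x hx, tri_dist Tr t ht v x (vert_mem_tri t v hv) hx]
  have h3 : (innerSL ℝ (Srf.n (Tr.a x)) : E3 →ₗ[ℝ] ℝ) v + -⟪Srf.n (Tr.a x), Tr.a x⟫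
      = ⟪Srf.n (Tr.a x), v - Tr.a x⟫ := by
    rw [inner_sub_right]; simp [sub_eq_add_neg]
  rw [h3]
  calc _ ≤ _ := h1
    _ ≤ C₁ * (2 * h) ^ 2 := by gcongr
    _ = _ := by ring

lemma foot_sq {C₁ : ℝ} (hC1 : 1 ≤ C₁)
    (hC : ∀ y ∈ Srf.S, ∀ y' ∈ Srf.S, |⟪Srf.n y, y' - y⟫| ≤ C₁ * ‖y' - y‖ ^ 2)
    (t : E3 × E3 × E3) (ht : t ∈ Tr.T) (x : E3) (hx : x ∈ triOf t) :
    ‖x - Tr.a x‖ ≤ 4 * C₁ * h ^ 2 := by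
  have hxN := tri_sub_N Tr t ht hx
  have hn := Srf.n_unit _ (Tr.a_mem x hxN)
  obtain ⟨σ, hσ⟩ := nearest_normal Srf x (Tr.a x) (Tr.a_mem x hxN) (Tr.a_nearest x hxN)
  have h1 := tri_bound t _ _ _ (vert_normal Tr hC1 hC t ht x hx) x hx
  have h3 : (innerSL ℝ (Srf.n (Tr.a x)) : E3 →ₗ[ℝ] ℝ) x + -⟪Srf.n (Tr.a x), Tr.a x⟫
      = ⟪Srf.n (Tr.a x), x - Tr.a x⟫ := by
    rw [inner_sub_right]; simp [sub_eq_add_neg]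
  rw [h3, hσ, real_inner_smul_right, real_inner_self_eq_norm_sq, hn] at h1
  rw [hσ, norm_smul, hn, Real.norm_eq_abs]
  simpa using h1

lemma dir_normal {C₁ : ℝ} (hC1 : 1 ≤ C₁)
    (hC : ∀ y ∈ Srf.S, ∀ y' ∈ Srf.S, |⟪Srf.n y, y' - y⟫| ≤ C₁ * ‖y' - y‖ ^ 2)
    (hγ : 0 < γ₀) (hh : 0 < h)
    (t : E3 × E3 × E3) (ht : t ∈ Tr.T) (x : E3) (hx : x ∈ triOf t) (d : E3) (hd : d ∈ dirOf t) :
    |⟪Srf.n (Tr.a x), d⟫| ≤ 8 * C₁ / γ₀ * h * ‖d‖ := by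
  have h1 := dir_bound Tr hγ hh t ht _ _ _ (vert_normal Tr hC1 hC t ht x hx) d hd
  have h2 : (innerSL ℝ (Srf.n (Tr.a x)) : E3 →ₗ[ℝ] ℝ) d = ⟪Srf.n (Tr.a x), d⟫ := by simp
  rw [h2] at h1
  refine h1.trans (le_of_eq ?_)
  field_simp
  ring

lemma a_diff (x : E3) (hx : x ∈ Tr.N) : DifferentiableAt ℝ Tr.a x :=
  (Tr.a_smooth.contDiffAt (Tr.N_open.mem_nhds hx)).differentiableAt (by simp)

/-- The derivative of `a` has tangential values. -/
lemma a_tangent {C₁ : ℝ} (_hC1 : 1 ≤ C₁)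
    (hC : ∀ y ∈ Srf.S, ∀ y' ∈ Srf.S, |⟪Srf.n y, y' - y⟫| ≤ C₁ * ‖y' - y‖ ^ 2)
    (x : E3) (hx : x ∈ Tr.N) (d : E3) :
    ⟪Srf.n (Tr.a x), fderiv ℝ Tr.a x d⟫ = 0 := by
  have hda := (a_diff Tr x hx).hasFDerivAt
  have h1 : HasFDerivAt (fun x' => ⟪Srf.n (Tr.a x), Tr.a x' - Tr.a x⟫)
      ((innerSL ℝ (Srf.n (Tr.a x))).comp (fderiv ℝ Tr.a x)) x := by
    have := (innerSL ℝ (Srf.n (Tr.a x))).hasFDerivAt (x := Tr.a x - Tr.a x)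
    exact this.comp x (hda.sub_const (Tr.a x))
  have h2 : HasFDerivAt (fun x' => ⟪Srf.n (Tr.a x), Tr.a x' - Tr.a x⟫)
      (0 : E3 →L[ℝ] ℝ) x := by
    have hO : (fun x' => Tr.a x' - Tr.a x) =O[nhds x] fun x' => x' - x := hda.isBigO_sub
    have hO2 : (fun x' => ⟪Srf.n (Tr.a x), Tr.a x' - Tr.a x⟫) =O[nhds x]
        fun x' => ‖x' - x‖ ^ 2 := by
      have : (fun x' => ⟪Srf.n (Tr.a x), Tr.a x' - Tr.a x⟫) =O[nhds x]
          fun x' => ‖Tr.a x' - Tr.a x‖ ^ 2 := by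
        refine Asymptotics.IsBigO.of_bound C₁ ?_
        filter_upwards [Tr.N_open.mem_nhds hx] with x' hx'
        have := hC _ (Tr.a_mem x hx) _ (Tr.a_mem x' hx')
        simpa using this
      exact this.trans (hO.norm_norm.pow 2)
    refine HasFDerivAt.of_isLittleO ?_
    simp only [sub_self, inner_zero_right, sub_zero, zero_apply]
    refine hO2.trans_isLittleO ?_
    have := Asymptotics.isLittleO_norm_pow_id (E' := E3) (n := 2) one_lt_two
    have h5 : Filter.Tendsto (fun x' => x' - x) (nhds x) (nhds 0) := by
      have : Filter.Tendsto (fun x' => x' - x) (nhds x) (nhds (x - x)) :=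
        (continuous_id.sub continuous_const).tendsto x
      simpa using this
    exact this.comp_tendsto h5
  have := h1.unique h2
  have h3 := congrArg (fun T : E3 →L[ℝ] ℝ => T d) this
  simpa using h3

/-- Comparison of a direction of the triangle and of its image under the derivative of `a`. -/
lemma a_deriv_close {C₁ C₃ : ℝ} (hC1 : 1 ≤ C₁)
    (hC : ∀ y ∈ Srf.S, ∀ y' ∈ Srf.S, |⟪Srf.n y, y' - y⟫| ≤ C₁ * ‖y' - y‖ ^ 2)
    (hC3 : ∀ y ∈ Srf.S, ‖fderiv ℝ Srf.n y‖ ≤ C₃)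
    (hγ : 0 < γ₀) (hh : 0 < h)
    (t : E3 × E3 × E3) (ht : t ∈ Tr.T) (x : E3) (hx : x ∈ triOf t) (d : E3) (hd : d ∈ dirOf t) :
    ‖d - fderiv ℝ Tr.a x d‖ ≤ 8 * C₁ / γ₀ * h * ‖d‖ + 8 * C₁ * C₃ * h ^ 2 * ‖fderiv ℝ Tr.a x d‖ := by
  have hxN := tri_sub_N Tr t ht hx
  have hyS := Tr.a_mem x hxN
  have hn := Srf.n_unit _ hyS
  have hda := (a_diff Tr x hxN).hasFDerivAt
  have hdn := (n_diff Srf _ hyS).hasFDerivAt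
  set y := Tr.a x with hy
  set u := fderiv ℝ Tr.a x d with hu
  have hna : HasFDerivAt (fun x' => Srf.n (Tr.a x')) ((fderiv ℝ Srf.n y).comp (fderiv ℝ Tr.a x)) x :=
    hdn.comp x hda
  have hσd : DifferentiableAt ℝ (fun x' => ⟪x' - Tr.a x', Srf.n (Tr.a x')⟫) x :=
    DifferentiableAt.inner ℝ (differentiableAt_id.sub (a_diff Tr x hxN)) hna.differentiableAt
  set σ' := fderiv ℝ (fun x' => ⟪x' - Tr.a x', Srf.n (Tr.a x')⟫) x with hσ'
  have h1 : HasFDerivAt (fun x' => x' - Tr.a x') (ContinuousLinearMap.id ℝ E3 - fderiv ℝ Tr.a x) x :=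
    (hasFDerivAt_id x).sub hda
  have h2 := hσd.hasFDerivAt.smul hna
  have heq : (fun x' => x' - Tr.a x') =ᶠ[nhds x]
      (fun x' => ⟪x' - Tr.a x', Srf.n (Tr.a x')⟫ • Srf.n (Tr.a x')) := by
    filter_upwards [Tr.N_open.mem_nhds hxN] with x' hx'
    obtain ⟨σ, hσ⟩ := nearest_normal Srf x' (Tr.a x') (Tr.a_mem x' hx') (Tr.a_nearest x' hx')
    rw [hσ, real_inner_smul_left, real_inner_self_eq_norm_sq, Srf.n_unit _ (Tr.a_mem x' hx')]
    simp
  have h3 := h1.unique (h2.congr_of_eventuallyEq heq)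
  have h4 : d - u = ⟪x - y, Srf.n y⟫ • (fderiv ℝ Srf.n y u) + σ' d • Srf.n y := by
    have := congrArg (fun T : E3 →L[ℝ] E3 => T d) h3
    simpa using this
  have htan : ⟪Srf.n y, u⟫ = 0 := a_tangent Tr hC1 hC x hxN d
  have hs : |⟪x - y, Srf.n y⟫| ≤ 4 * C₁ * h ^ 2 := by
    refine (abs_real_inner_le_norm _ _).trans ?_
    rw [hn, mul_one]; exact foot_sq Tr hC1 hC t ht x hx
  have hnu : ‖fderiv ℝ Srf.n y u‖ ≤ C₃ * ‖u‖ :=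
    ((fderiv ℝ Srf.n y).le_opNorm u).trans (by gcongr; exact hC3 y hyS)
  have hterm : ‖⟪x - y, Srf.n y⟫ • (fderiv ℝ Srf.n y u)‖ ≤ 4 * C₁ * h ^ 2 * (C₃ * ‖u‖) := by
    rw [norm_smul, Real.norm_eq_abs]; gcongr
  have h5 : σ' d = ⟪Srf.n y, d⟫ - ⟪Srf.n y, ⟪x - y, Srf.n y⟫ • (fderiv ℝ Srf.n y u)⟫ := by
    have := congrArg (fun w => ⟪Srf.n y, w⟫) h4
    simp only [inner_sub_right, inner_add_right] at this
    rw [htan, real_inner_smul_right (Srf.n y) (Srf.n y) (σ' d), real_inner_self_eq_norm_sq, hn] at this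
    linarith
  have h6 : |σ' d| ≤ 8 * C₁ / γ₀ * h * ‖d‖ + 4 * C₁ * h ^ 2 * (C₃ * ‖u‖) := by
    rw [h5]
    refine (abs_sub _ _).trans ?_
    have := abs_real_inner_le_norm (Srf.n y) (⟪x - y, Srf.n y⟫ • (fderiv ℝ Srf.n y u))
    rw [hn, one_mul] at this
    linarith [dir_normal Tr hC1 hC hγ hh t ht x hx d hd]
  rw [h4]
  refine (norm_add_le _ _).trans ?_
  rw [norm_smul (σ' d), hn, mul_one, Real.norm_eq_abs]
  linarith

lemma finrank_dir (t : E3 × E3 × E3) (ht : t ∈ Tr.T) : Module.finrank ℝ (dirOf t) = 2 := by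
  have h1 := (Tr.indep t ht).finrank_vectorSpan (n := 2) (by simp)
  have h2 : Set.range ![t.1, t.2.1, t.2.2] = vertsOf t := by
    simp [vertsOf, Matrix.range_cons, Matrix.range_empty]
    ext; simp; tauto
  rw [h2] at h1
  rw [dirOf, direction_affineSpan]; exact h1

lemma finrank_tangent (y : E3) (hy : y ∈ Srf.S) : Module.finrank ℝ (Srf.tangent y) = 2 := by
  have : Fact (Module.finrank ℝ E3 = 2 + 1) := ⟨by simp⟩
  have hn : Srf.n y ≠ 0 := by
    intro h0; have := Srf.n_unit y hy; rw [h0] at this; simp at this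
  exact Submodule.finrank_orthogonal_span_singleton hn

/-- The derivative of `a` maps the directions of the triangle onto the tangent plane. -/
lemma a_surj {C₁ : ℝ} (hC1 : 1 ≤ C₁)
    (hC : ∀ y ∈ Srf.S, ∀ y' ∈ Srf.S, |⟪Srf.n y, y' - y⟫| ≤ C₁ * ‖y' - y‖ ^ 2)
    (t : E3 × E3 × E3) (ht : t ∈ Tr.T) (x : E3) (hx : x ∈ triOf t)
    (hinj : ∀ d ∈ dirOf t, fderiv ℝ Tr.a x d = 0 → d = 0) (u : E3)
    (hu : u ∈ Srf.tangent (Tr.a x)) : ∃ d ∈ dirOf t, fderiv ℝ Tr.a x d = u := by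
  have hxN := tri_sub_N Tr t ht hx
  have hmem : ∀ d : E3, fderiv ℝ Tr.a x d ∈ Srf.tangent (Tr.a x) := fun d => by
    rw [SmoothSurface.tangent, Submodule.mem_orthogonal_singleton_iff_inner_right]
    exact a_tangent Tr hC1 hC x hxN d
  let A : dirOf t →ₗ[ℝ] Srf.tangent (Tr.a x) :=
    LinearMap.codRestrict _ ((fderiv ℝ Tr.a x : E3 →ₗ[ℝ] E3).comp (dirOf t).subtype)
      (fun d => hmem d)
  have hA : Function.Injective A := by
    rw [injective_iff_map_eq_zero]
    intro d hd
    have : fderiv ℝ Tr.a x d = 0 := congrArg Subtype.val hd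
    exact Subtype.ext (hinj d d.2 this)
  have hA2 : Function.Surjective A :=
    (LinearMap.injective_iff_surjective_of_finrank_eq_finrank
      ((finrank_dir Tr t ht).trans (finrank_tangent _ (Tr.a_mem x hxN)).symm)).1 hA
  obtain ⟨d, hd⟩ := hA2 ⟨u, hu⟩
  exact ⟨d, d.2, congrArg Subtype.val hd⟩

/-- Bounding the tangential gradient through the pull-back to the triangle. -/
lemma grad_bound (t : E3 × E3 × E3) (ht : t ∈ Tr.T) (x : E3) (hx : x ∈ triOf t)
    (hsurj : ∀ u ∈ Srf.tangent (Tr.a x), ∃ d ∈ dirOf t, fderiv ℝ Tr.a x d = u)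
    (w φ : E3 → ℝ) (φ' : E3 →L[ℝ] ℝ) (hφ : HasFDerivWithinAt φ φ' (triOf t) x)
    (hw : ∀ x' ∈ triOf t, w (Tr.a x') = φ x') (B : ℝ) (hB : 0 ≤ B)
    (hbd : ∀ d ∈ dirOf t, |φ' d| ≤ B * ‖fderiv ℝ Tr.a x d‖) :
    ‖Srf.grad w (Tr.a x)‖ ≤ B := by
  have hxN := tri_sub_N Tr t ht hx
  by_cases hd : DifferentiableWithinAt ℝ w Srf.S (Tr.a x)
  swap
  · rw [SmoothSurface.grad, tGrad, fderivWithin_zero_of_not_differentiableWithinAt hd]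
    simpa using hB
  have hD := hd.hasFDerivWithinAt
  set D := fderivWithin ℝ w Srf.S (Tr.a x) with hDdef
  have h1 : HasFDerivWithinAt (fun x' => w (Tr.a x')) (D.comp (fderiv ℝ Tr.a x)) (triOf t) x :=
    hD.comp x (a_diff Tr x hxN).hasFDerivAt.hasFDerivWithinAt
      (fun x' hx' => Tr.a_mem x' (tri_sub_N Tr t ht hx'))
  have h2 : HasFDerivWithinAt (fun x' => w (Tr.a x')) φ' (triOf t) x :=
    hφ.congr hw (hw x hx)
  have h3 := h1.unique_on h2
  have hcone : ∀ p ∈ triOf t, D (fderiv ℝ Tr.a x (p - x)) = φ' (p - x) := by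
    intro p hp
    exact h3 (mem_tangentConeAt_of_segment_subset ((tri_convex t).segment_subset hx hp))
  have hdir : ∀ d ∈ dirOf t, D (fderiv ℝ Tr.a x d) = φ' d := by
    intro d hd
    rw [dirOf, direction_affineSpan, vectorSpan_def] at hd
    induction hd using Submodule.span_induction with
    | mem q hq =>
      obtain ⟨p, hp, p', hp', rfl⟩ := hq
      have : p -ᵥ p' = (p - x) - (p' - x) := by simp
      simp only [this]
      rw [map_sub (fderiv ℝ Tr.a x) (p - x), map_sub D, map_sub φ' (p - x), hcone p (vert_mem_tri t p hp), hcone p' (vert_mem_tri t p' hp')]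
    | zero => simp
    | add q q' _ _ h h' => rw [map_add, map_add, map_add, h, h']
    | smul c q _ h => rw [map_smul, map_smul, map_smul, h]
  set g := (InnerProductSpace.toDual ℝ E3).symm D with hg
  have hgD : ∀ v, ⟪g, v⟫ = D v := fun v => by simp [hg]
  have hgr : Srf.grad w (Tr.a x) =
      (Submodule.orthogonalProjectionOnto (Srf.tangent (Tr.a x)) g : E3) := rfl
  rw [hgr]
  set u := Submodule.orthogonalProjectionOnto (Srf.tangent (Tr.a x)) g with hu
  obtain ⟨d, hd, hdu⟩ := hsurj u u.2
  have h4 : ‖(u : E3)‖ ^ 2 = φ' d := by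
    rw [← hdir d hd, hdu, ← hgD, ← real_inner_self_eq_norm_sq]
    have := Submodule.starProjection_inner_eq_zero (K := Srf.tangent (Tr.a x)) g u u.2
    rw [inner_sub_left] at this
    rw [Submodule.starProjection_apply] at this
    linarith
  have h5 := hbd d hd
  rw [hdu] at h5
  have h6 := le_abs_self (φ' d)
  by_contra hcon
  push Not at hcon
  nlinarith [norm_nonneg (u : E3)]

end TriSec



/-! ### The cut-off logarithm -/

/-- Logarithm of the length of the projected vector. -/
def lg (n z x : E3) : ℝ := Real.log ‖prj n (x - z)‖

/-- Derivative of `lg`. -/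
def lgD (n z x : E3) : E3 →L[ℝ] ℝ := (‖prj n (x - z)‖ ^ 2)⁻¹ • innerSL ℝ (prj n (x - z))

lemma lg_hasFDerivAt (n z x : E3) (hn : ‖n‖ = 1) (hx : prj n (x - z) ≠ 0) :
    HasFDerivAt (lg n z) (lgD n z x) x := by
  have hpos : 0 < ‖prj n (x - z)‖ := norm_pos_iff.2 hx
  have h1 : HasFDerivAt (fun y : E3 => prj n (y - z)) (prj n) x := by
    have := (prj n).hasFDerivAt (x := x - z)
    have h2 := this.comp x ((hasFDerivAt_id x).sub_const z)
    rw [ContinuousLinearMap.comp_id] at h2; exact h2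
  have h2 := (h1.norm_sq).log (by positivity)
  have h3 : lg n z = fun y => (1 / 2 : ℝ) * Real.log (‖prj n (y - z)‖ ^ 2) := by
    funext y
    rw [lg, Real.log_pow]; push_cast; ring
  rw [h3]
  refine (h2.const_mul (1 / 2 : ℝ)).congr_fderiv ?_
  ext v
  simp only [lgD, smul_apply, ContinuousLinearMap.comp_apply, innerSL_apply_apply, smul_eq_mul,
    nsmul_eq_mul, prj_inner _ _ _ hn]
  push_cast
  ring

lemma lgD_norm (n z x : E3) : ‖lgD n z x‖ = 1 / ‖prj n (x - z)‖ := by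
  rw [lgD, norm_smul, innerSL_apply_norm, Real.norm_eq_abs, abs_of_nonneg (by positivity)]
  by_cases h : ‖prj n (x - z)‖ = 0
  · rw [h]; simp
  · field_simp

lemma inv_diff (a b : E3) (ha : a ≠ 0) (hb : b ≠ 0) :
    ‖(‖a‖ ^ 2)⁻¹ • a - (‖b‖ ^ 2)⁻¹ • b‖ = ‖a - b‖ / (‖a‖ * ‖b‖) := by
  have := EuclideanGeometry.dist_inversion_inversion (c := (0 : E3)) ha hb 1
  simp only [EuclideanGeometry.inversion, dist_zero_right, vsub_eq_sub, sub_zero, vadd_eq_add,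
    add_zero, one_div, inv_pow, one_pow] at this
  rw [dist_eq_norm, dist_eq_norm] at this
  rw [this]
  field_simp

lemma lgD_diff (n z p q : E3) (hn : ‖n‖ = 1) (hp : prj n (p - z) ≠ 0) (hq : prj n (q - z) ≠ 0) :
    ‖lgD n z p - lgD n z q‖ ≤ ‖p - q‖ / (‖prj n (p - z)‖ * ‖prj n (q - z)‖) := by
  have h1 : lgD n z p - lgD n z q = innerSL ℝ ((‖prj n (p - z)‖ ^ 2)⁻¹ • prj n (p - z) -
      (‖prj n (q - z)‖ ^ 2)⁻¹ • prj n (q - z)) := by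
    simp only [lgD, map_sub, map_smul]
  rw [h1, innerSL_apply_norm, inv_diff _ _ hp hq]
  gcongr
  rw [← map_sub]
  refine (prj_norm_le n _ hn).trans (le_of_eq ?_)
  congr 1; abel

lemma log_diff (a b m : ℝ) (hm : 0 < m) (ha : m ≤ a) (hb : m ≤ b) :
    |Real.log a - Real.log b| ≤ |a - b| / m := by
  have key : ∀ a b : ℝ, m ≤ a → m ≤ b → Real.log a - Real.log b ≤ |a - b| / m := by
    intro a b ha hb
    have ha0 : 0 < a := by linarith
    have hb0 : 0 < b := by linarith
    rw [← Real.log_div ha0.ne' hb0.ne']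
    have h1 := Real.log_le_sub_one_of_pos (div_pos ha0 hb0)
    have h2 : a / b - 1 = (a - b) / b := by field_simp
    rw [h2] at h1
    refine h1.trans ?_
    calc (a - b) / b ≤ |a - b| / b := by gcongr; exact le_abs_self _
      _ ≤ |a - b| / m := by gcongr
  rw [abs_le]
  constructor
  · have := key b a hb ha
    rw [abs_sub_comm] at this; linarith
  · exact key a b ha hb

lemma log_bound (r m : ℝ) (hm : 0 < m) (h1 : m ≤ r) (h2 : r ≤ 3) : |Real.log r| ≤ 4 / m := by
  have hr : 0 < r := by linarith
  rw [abs_le]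
  constructor
  · have := Real.log_le_sub_one_of_pos (inv_pos.2 hr)
    rw [Real.log_inv] at this
    have h3 : r⁻¹ ≤ 1 / m := by rw [← one_div]; gcongr
    have h4 : 1 / m ≤ 4 / m := by gcongr; norm_num
    linarith
  · have := Real.log_le_sub_one_of_pos hr
    have h3 : (4 : ℝ) / 3 ≤ 4 / m := by gcongr; linarith
    have h5 : Real.log r ≤ Real.log 3 := Real.log_le_log hr h2
    have h6 : Real.log 3 ≤ 4 / 3 := by
      have : Real.log 3 = Real.log (3 / 2) + Real.log 2 := by
        rw [← Real.log_mul (by norm_num) (by norm_num)]; norm_num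
      have h7 := Real.log_le_sub_one_of_pos (show (0 : ℝ) < 3 / 2 by norm_num)
      linarith [Real.log_two_lt_d9]
    linarith

/-- Derivative of the cut-off logarithm. -/
def cutD (n z : E3) (ζ : E3 → ℝ) (x : E3) : E3 →L[ℝ] ℝ :=
  ζ x • lgD n z x + lg n z x • fderiv ℝ ζ x

lemma cut_hasFDerivAt (Srf : SmoothSurface) (z : E3) (hz : z ∈ Srf.S) (ζ : E3 → ℝ)
    (hζ : ContDiff ℝ (⊤ : ℕ∞) ζ) (x : E3) (hx : 0 < Srf.rfn z x) :
    HasFDerivAt (cutLog Srf z ζ) (cutD (Srf.n z) z ζ x) x := by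
  rw [rfn_eq _ _ _ hz, norm_pos_iff] at hx
  have h1 : cutLog Srf z ζ = fun y => ζ y * lg (Srf.n z) z y := by
    funext y; rw [cutLog, rfn_eq _ _ _ hz, lg]
  rw [h1]
  have hd : Differentiable ℝ ζ := hζ.differentiable (by simp)
  exact (hd x).hasFDerivAt.mul (lg_hasFDerivAt _ z x (Srf.n_unit z hz) hx)

lemma cut_bd0 {z : E3} {r₁ Cζ : ℝ} {ζ : E3 → ℝ} (hζ : IsCutoff z r₁ Cζ ζ)
    (x : E3) : |ζ x| ≤ Cζ := by
  have := hζ.2.2.2 x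
  linarith [norm_nonneg (fderiv ℝ ζ x), norm_nonneg (fderiv ℝ (fderiv ℝ ζ) x)]

lemma cut_bd1 {z : E3} {r₁ Cζ : ℝ} {ζ : E3 → ℝ} (hζ : IsCutoff z r₁ Cζ ζ)
    (x : E3) : ‖fderiv ℝ ζ x‖ ≤ Cζ := by
  have := hζ.2.2.2 x
  linarith [abs_nonneg (ζ x), norm_nonneg (fderiv ℝ (fderiv ℝ ζ) x)]

lemma cut_bd2 {z : E3} {r₁ Cζ : ℝ} {ζ : E3 → ℝ} (hζ : IsCutoff z r₁ Cζ ζ)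
    (x : E3) : ‖fderiv ℝ (fderiv ℝ ζ) x‖ ≤ Cζ := by
  have := hζ.2.2.2 x
  linarith [abs_nonneg (ζ x), norm_nonneg (fderiv ℝ ζ x)]

lemma cut_lip0 {z : E3} {r₁ Cζ : ℝ} {ζ : E3 → ℝ} (hζ : IsCutoff z r₁ Cζ ζ)
    (p q : E3) : |ζ p - ζ q| ≤ Cζ * ‖p - q‖ := by
  have hd : Differentiable ℝ ζ := hζ.1.differentiable (by simp)
  exact convex_univ.norm_image_sub_le_of_norm_fderiv_le (f := ζ) (𝕜 := ℝ) (fun x _ => hd x)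
    (fun x _ => cut_bd1 hζ x) (Set.mem_univ q) (Set.mem_univ p)

lemma cut_lip1 {z : E3} {r₁ Cζ : ℝ} {ζ : E3 → ℝ} (hζ : IsCutoff z r₁ Cζ ζ)
    (p q : E3) : ‖fderiv ℝ ζ p - fderiv ℝ ζ q‖ ≤ Cζ * ‖p - q‖ := by
  have hd : Differentiable ℝ (fderiv ℝ ζ) :=
    (hζ.1.fderiv_right (m := 1) (by norm_cast)).differentiable (by simp)
  exact convex_univ.norm_image_sub_le_of_norm_fderiv_le (f := fderiv ℝ ζ) (𝕜 := ℝ) (fun x _ => hd x)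
    (fun x _ => cut_bd2 hζ x) (Set.mem_univ q) (Set.mem_univ p)

lemma cutD_norm {z : E3} {r₁ Cζ : ℝ} {ζ : E3 → ℝ} (hζ : IsCutoff z r₁ Cζ ζ)
    (n : E3) (m : ℝ) (hm : 0 < m) (p : E3)
    (hp : m ≤ ‖prj n (p - z)‖) (hp3 : ‖prj n (p - z)‖ ≤ 3) :
    ‖cutD n z ζ p‖ ≤ 5 * Cζ / m := by
  rw [cutD]
  refine (norm_add_le _ _).trans ?_
  rw [norm_smul, norm_smul, lgD_norm, Real.norm_eq_abs, Real.norm_eq_abs]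
  have hC : 0 ≤ Cζ := (abs_nonneg _).trans (cut_bd0 hζ p)
  have h1 : |ζ p| * (1 / ‖prj n (p - z)‖) ≤ Cζ * (1 / m) := by
    gcongr; exact cut_bd0 hζ p
  have h2 : |lg n z p| * ‖fderiv ℝ ζ p‖ ≤ 4 / m * Cζ := by
    have := log_bound _ m hm hp hp3
    gcongr
    · exact this
    · exact cut_bd1 hζ p
  calc _ ≤ _ := add_le_add h1 h2
    _ = _ := by ring

lemma cutD_diff {z : E3} {r₁ Cζ : ℝ} {ζ : E3 → ℝ} (hζ : IsCutoff z r₁ Cζ ζ)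
    (n : E3) (hn : ‖n‖ = 1) (m : ℝ) (hm : 0 < m) (p q : E3)
    (hp : m ≤ ‖prj n (p - z)‖) (hp3 : ‖prj n (p - z)‖ ≤ 3)
    (hq : m ≤ ‖prj n (q - z)‖) (hq3 : ‖prj n (q - z)‖ ≤ 3) :
    ‖cutD n z ζ p - cutD n z ζ q‖ ≤ 19 * Cζ / m ^ 2 * ‖p - q‖ := by
  have hC : 0 ≤ Cζ := (abs_nonneg _).trans (cut_bd0 hζ p)
  have hdec : cutD n z ζ p - cutD n z ζ q = (ζ p - ζ q) • lgD n z p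
      + ζ q • (lgD n z p - lgD n z q) + (lg n z p - lg n z q) • fderiv ℝ ζ p
      + lg n z q • (fderiv ℝ ζ p - fderiv ℝ ζ q) := by
    simp only [cutD]; module
  have hp0 : prj n (p - z) ≠ 0 := norm_pos_iff.1 (by linarith)
  have hq0 : prj n (q - z) ≠ 0 := norm_pos_iff.1 (by linarith)
  have h1 : ‖(ζ p - ζ q) • lgD n z p‖ ≤ Cζ * ‖p - q‖ * (1 / m) := by
    rw [norm_smul, lgD_norm, Real.norm_eq_abs]
    gcongr; exact cut_lip0 hζ p q
  have h2 : ‖ζ q • (lgD n z p - lgD n z q)‖ ≤ Cζ * (‖p - q‖ / (m * m)) := by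
    rw [norm_smul, Real.norm_eq_abs]
    gcongr
    · exact cut_bd0 hζ q
    · refine (lgD_diff n z p q hn hp0 hq0).trans ?_
      gcongr
  have h3 : ‖(lg n z p - lg n z q) • fderiv ℝ ζ p‖ ≤ ‖p - q‖ / m * Cζ := by
    rw [norm_smul, Real.norm_eq_abs]
    gcongr
    · refine (log_diff _ _ m hm hp hq).trans ?_
      gcongr
      refine (abs_norm_sub_norm_le _ _).trans ?_
      rw [← map_sub]
      refine (prj_norm_le n _ hn).trans (le_of_eq ?_)
      congr 1; abel
    · exact cut_bd1 hζ p
  have h4 : ‖lg n z q • (fderiv ℝ ζ p - fderiv ℝ ζ q)‖ ≤ 4 / m * (Cζ * ‖p - q‖) := by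
    rw [norm_smul, Real.norm_eq_abs]
    gcongr
    · exact log_bound _ m hm hq hq3
    · exact cut_lip1 hζ p q
  rw [hdec]
  have hm3 : m ≤ 3 := hp.trans hp3
  have h5 : 1 / m ≤ 3 / m ^ 2 := by
    rw [div_le_div_iff₀ hm (by positivity)]; nlinarith
  calc _ ≤ _ := norm_add₄_le
    _ ≤ Cζ * ‖p - q‖ * (1 / m) + Cζ * (‖p - q‖ / (m * m)) + ‖p - q‖ / m * Cζ
        + 4 / m * (Cζ * ‖p - q‖) := by gcongr
    _ = 6 * (Cζ * ‖p - q‖) * (1 / m) + Cζ * ‖p - q‖ / m ^ 2 := by ring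
    _ ≤ 6 * (Cζ * ‖p - q‖) * (3 / m ^ 2) + Cζ * ‖p - q‖ / m ^ 2 := by gcongr
    _ = _ := by ring



/-! ### Measure of pieces of the surface -/

lemma ball_measure_small (Srf : SmoothSurface) : ∃ δ > 0, ∀ z ∈ Srf.S, ∀ ρ : ℝ, 0 < ρ → ρ ≤ δ →
    μH[2] (Srf.S ∩ closedBall z ρ) ≤ ENNReal.ofReal (64 * ρ ^ 2) := by
  obtain ⟨C, hC1, hC⟩ := quad_normal Srf
  have huc := Srf.compact.uniformContinuousOn_of_continuous (n_cont Srf)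
  rw [Metric.uniformContinuousOn_iff_le] at huc
  obtain ⟨δ₁, hδ₁, huc⟩ := huc (1 / 4) (by norm_num)
  refine ⟨min δ₁ (1 / (8 * C)), lt_min hδ₁ (by positivity), fun z hz ρ hρ hρδ => ?_⟩
  have hn := Srf.n_unit z hz
  have hρ1 : ρ ≤ δ₁ := hρδ.trans (min_le_left _ _)
  have hρ2 : ρ * (8 * C) ≤ 1 := by
    rw [← le_div_iff₀ (by positivity)]; exact hρδ.trans (min_le_right _ _)
  set A := Srf.S ∩ closedBall z ρ with hA
  -- the projection is bi-Lipschitz on `A`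
  have hlow : ∀ y ∈ A, ∀ y' ∈ A, ‖y - y'‖ ≤ 2 * ‖prj (Srf.n z) (y - y')‖ := by
    intro y hy y' hy'
    have hyz : ‖y - z‖ ≤ ρ := by rw [← dist_eq_norm]; exact hy.2
    have hyz' : ‖y' - z‖ ≤ ρ := by rw [← dist_eq_norm]; exact hy'.2
    have h0 : ‖y - y'‖ ≤ 2 * ρ := by
      have : y - y' = (y - z) - (y' - z) := by abel
      rw [this]; refine (norm_sub_le _ _).trans ?_; linarith
    have h1 := hC y' hy'.1 y hy.1
    have h2 : ‖Srf.n z - Srf.n y'‖ ≤ 1 / 4 := by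
      rw [← dist_eq_norm]
      exact huc z hz y' hy'.1 (by rw [dist_comm, dist_eq_norm]; linarith)
    have h3 : |⟪Srf.n z, y - y'⟫| ≤ 1 / 2 * ‖y - y'‖ := by
      have e : ⟪Srf.n z, y - y'⟫ = ⟪Srf.n y', y - y'⟫ + ⟪Srf.n z - Srf.n y', y - y'⟫ := by
        rw [inner_sub_left (Srf.n z)]; ring
      rw [e]
      refine (abs_add_le _ _).trans ?_
      have h4 := abs_real_inner_le_norm (Srf.n z - Srf.n y') (y - y')
      have h5 : C * ‖y - y'‖ ^ 2 ≤ 1 / 4 * ‖y - y'‖ := by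
        have : C * ‖y - y'‖ ≤ 1 / 4 := by nlinarith
        nlinarith [norm_nonneg (y - y')]
      nlinarith [norm_nonneg (y - y')]
    have h6 := prj_norm_sq (Srf.n z) (y - y') hn
    have h7 : ⟪Srf.n z, y - y'⟫ ^ 2 ≤ (1 / 2 * ‖y - y'‖) ^ 2 := by
      rw [← sq_abs]; gcongr
    refine abs_le_of_sq_le_sq' ?_ (by positivity) |>.2
    nlinarith [sq_nonneg ‖y - y'‖]
  have : Fact (Module.finrank ℝ E3 = 2 + 1) := ⟨by simp⟩
  have hn0 : Srf.n z ≠ 0 := by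
    intro h0; rw [h0] at hn; simp at hn
  let b := OrthonormalBasis.fromOrthogonalSpanSingleton (𝕜 := ℝ) 2 hn0
  let pr : E3 → EuclideanSpace ℝ (Fin 2) := fun v =>
    b.repr (Submodule.orthogonalProjectionOnto (ℝ ∙ Srf.n z)ᗮ v)
  have hprsub : ∀ v w, pr (v - w) = pr v - pr w := fun v w => by simp [pr]
  have hprn : ∀ v, ‖pr v‖ = ‖prj (Srf.n z) v‖ := fun v => by
    rw [← proj_eq _ _ hn]
    simp only [pr, LinearIsometryEquiv.norm_map, Submodule.coe_norm]
  have hsup : ∀ w : EuclideanSpace ℝ (Fin 2), ‖w‖ ≤ 2 * ‖(WithLp.ofLp w : Fin 2 → ℝ)‖ := by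
    intro w
    have h1 := norm_le_pi_norm (WithLp.ofLp w) 0
    have h2 := norm_le_pi_norm (WithLp.ofLp w) 1
    have h3 := EuclideanSpace.norm_sq_eq w
    rw [Fin.sum_univ_two] at h3
    refine abs_le_of_sq_le_sq' ?_ (by positivity) |>.2
    nlinarith [norm_nonneg (w.ofLp 0), norm_nonneg (w.ofLp 1)]
  have hsup2 : ∀ w : EuclideanSpace ℝ (Fin 2), ‖(WithLp.ofLp w : Fin 2 → ℝ)‖ ≤ ‖w‖ := by
    intro w
    rw [pi_norm_le_iff_of_nonneg (norm_nonneg _)]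
    exact fun i => PiLp.norm_apply_le w i
  let φ : A → (Fin 2 → ℝ) := fun y => WithLp.ofLp (pr (y - z))
  have hφ : AntilipschitzWith 4 φ := by
    refine AntilipschitzWith.of_le_mul_dist fun y y' => ?_
    rw [Subtype.dist_eq, dist_eq_norm, dist_eq_norm]
    have e : φ y - φ y' = WithLp.ofLp (pr ((y : E3) - y')) := by
      have : (y : E3) - y' = (y - z) - (y' - z) := by abel
      rw [this, hprsub]; rfl
    rw [e]
    have h1 := hlow y y.2 y' y'.2
    have h2 := hsup (pr ((y : E3) - y'))
    rw [hprn] at h2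
    push_cast
    linarith
  have hpre : (Set.univ : Set A) ⊆ φ ⁻¹' (closedBall 0 ρ) := by
    intro y _
    rw [Set.mem_preimage, mem_closedBall, dist_zero_right]
    refine (hsup2 _).trans ?_
    rw [hprn]
    refine (prj_norm_le _ _ hn).trans ?_
    rw [← dist_eq_norm]; exact y.2.2
  have h1 : μH[2] A = μH[2] (Set.univ : Set A) := by
    have := (isometry_subtype_coe (s := A)).hausdorffMeasure_image (d := 2) (Or.inl (by norm_num))
      Set.univ
    rw [Set.image_univ, Subtype.range_coe] at this
    exact this
  have h2 : (μH[2] : Measure (Fin 2 → ℝ)) = volume := by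
    have := hausdorffMeasure_pi_real (ι := Fin 2)
    simpa using this
  calc μH[2] A = μH[2] (Set.univ : Set A) := h1
    _ ≤ μH[2] (φ ⁻¹' (closedBall 0 ρ)) := measure_mono hpre
    _ ≤ ((4 : ℝ≥0) : ℝ≥0∞) ^ (2 : ℝ) * μH[2] (closedBall (0 : Fin 2 → ℝ) ρ) :=
        hφ.hausdorffMeasure_preimage_le (by norm_num) _
    _ = ENNReal.ofReal (64 * ρ ^ 2) := by
        rw [h2, Real.volume_pi_closedBall _ hρ.le]
        have : ((4 : ℝ≥0) : ℝ≥0∞) ^ (2 : ℝ) = ENNReal.ofReal 16 := by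
          rw [show (2 : ℝ) = ((2 : ℕ) : ℝ) by norm_num, ENNReal.rpow_natCast]
          norm_num
        rw [this, ← ENNReal.ofReal_mul (by norm_num)]
        congr 1
        simp
        ring

lemma surface_finite (Srf : SmoothSurface) : μH[2] Srf.S < ⊤ := by
  obtain ⟨δ, hδ, h⟩ := ball_measure_small Srf
  obtain ⟨s, hs, hcov⟩ := Srf.compact.elim_nhds_subcover (fun z => closedBall z δ)
    (fun z _ => closedBall_mem_nhds z hδ)
  have hsub : Srf.S ⊆ ⋃ z ∈ s, (Srf.S ∩ closedBall z δ) := by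
    intro y hy
    obtain ⟨z, hz, hyz⟩ := Set.mem_iUnion₂.1 (hcov hy)
    exact Set.mem_iUnion₂.2 ⟨z, hz, hy, hyz⟩
  refine (measure_mono hsub).trans_lt ?_
  refine (measure_biUnion_finset_le _ _).trans_lt ?_
  exact ENNReal.sum_lt_top.2 fun z hz =>
    (h z (hs z hz) δ hδ le_rfl).trans_lt ENNReal.ofReal_lt_top

lemma ball_measure (Srf : SmoothSurface) : ∃ C > 0, ∀ z ∈ Srf.S, ∀ ρ : ℝ, 0 < ρ →
    (μH[2] (Srf.S ∩ closedBall z ρ)).toReal ≤ C * ρ ^ 2 := by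
  obtain ⟨δ, hδ, h⟩ := ball_measure_small Srf
  have hfin := surface_finite Srf
  refine ⟨64 + (μH[2] Srf.S).toReal / δ ^ 2, by positivity, fun z hz ρ hρ => ?_⟩
  rcases le_total ρ δ with hle | hle
  · have h1 := ENNReal.toReal_mono ENNReal.ofReal_ne_top (h z hz ρ hρ hle)
    rw [ENNReal.toReal_ofReal (by positivity)] at h1
    refine h1.trans ?_
    gcongr
    have : 0 ≤ (μH[2] Srf.S).toReal / δ ^ 2 := by positivity
    linarith
  · have h1 := ENNReal.toReal_mono hfin.ne
      (measure_mono (Set.inter_subset_left : Srf.S ∩ closedBall z ρ ⊆ Srf.S))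
    refine h1.trans ?_
    have h2 : (μH[2] Srf.S).toReal ≤ (μH[2] Srf.S).toReal / δ ^ 2 * ρ ^ 2 := by
      rw [div_mul_eq_mul_div, le_div_iff₀ (by positivity)]
      gcongr
    nlinarith [sq_nonneg ρ]

/-- Dyadic summation. -/
lemma dyadic (Srf : SmoothSurface) (C : ℝ)
    (hC : ∀ z ∈ Srf.S, ∀ ρ : ℝ, 0 < ρ → (μH[2] (Srf.S ∩ closedBall z ρ)).toReal ≤ C * ρ ^ 2)
    (z : E3) (hz : z ∈ Srf.S) (ε : ℝ) (hε : 0 < ε) (K : ℕ) (A : Set E3) (hA : MeasurableSet A)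
    (hAS : A ⊆ Srf.S) (hlow : ∀ y ∈ A, ε ≤ ‖y - z‖) (hup : ∀ y ∈ A, ‖y - z‖ < 2 ^ K * ε)
    (j : ℕ) (f : E3 → ℝ) (B : ℝ) (hB : 0 ≤ B) (hf0 : ∀ y ∈ A, 0 ≤ f y)
    (hf : ∀ y ∈ A, f y ≤ B / ‖y - z‖ ^ j) :
    ∫ y in A, f y ∂μH[2] ≤ ∑ i ∈ Finset.range K, B / (2 ^ i * ε) ^ j * (C * (2 ^ (i + 1) * ε) ^ 2) := by
  have hfinS := surface_finite Srf
  set μ : Measure E3 := (μH[2]).restrict A with hμ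
  have hfin : IsFiniteMeasure μ := ⟨by
    rw [hμ, Measure.restrict_apply_univ]; exact (measure_mono hAS).trans_lt hfinS⟩
  let g : E3 → ℝ := fun y => ∑ i ∈ Finset.range K,
    (closedBall z (2 ^ (i + 1) * ε)).indicator (fun _ => B / (2 ^ i * ε) ^ j) y
  have hgi : ∀ i ∈ Finset.range K, Integrable ((closedBall z (2 ^ (i + 1) * ε)).indicator
      (fun _ => B / (2 ^ i * ε) ^ j)) μ := fun i _ =>
    (integrable_const _).indicator isClosed_closedBall.measurableSet
  have hgint : Integrable g μ := integrable_finset_sum _ hgi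
  have hle : ∀ y ∈ A, f y ≤ g y := by
    intro y hy
    have h1 := hlow y hy
    have h2 := hup y hy
    have hex : ∃ i : ℕ, ‖y - z‖ < 2 ^ i * ε := ⟨K, h2⟩
    classical
    set i := Nat.find hex with hi
    have hi1 : ‖y - z‖ < 2 ^ i * ε := Nat.find_spec hex
    have hi0 : i ≠ 0 := by
      intro h0
      rw [h0] at hi1
      simp at hi1; linarith
    obtain ⟨k, hk⟩ := Nat.exists_eq_succ_of_ne_zero hi0
    have hiK : i ≤ K := Nat.find_min' hex h2
    have hk1 : 2 ^ k * ε ≤ ‖y - z‖ := by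
      have := Nat.find_min hex (m := k) (by omega)
      push Not at this; exact this
    have hkK : k ∈ Finset.range K := by rw [Finset.mem_range]; omega
    have h3 : f y ≤ (closedBall z (2 ^ (k + 1) * ε)).indicator (fun _ => B / (2 ^ k * ε) ^ j) y := by
      rw [Set.indicator_of_mem]
      · refine (hf y hy).trans ?_
        gcongr
      · rw [mem_closedBall, dist_eq_norm]
        rw [hk] at hi1; exact hi1.le
    refine h3.trans ?_
    refine Finset.single_le_sum (f := fun i => (closedBall z (2 ^ (i + 1) * ε)).indicator
      (fun _ => B / (2 ^ i * ε) ^ j) y) (fun i _ => ?_) hkK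
    exact Set.indicator_nonneg (fun _ _ => by positivity) y
  have hmono : ∫ y, f y ∂μ ≤ ∫ y, g y ∂μ := by
    refine integral_mono_of_nonneg ?_ hgint ?_
    · exact ae_restrict_of_forall_mem hA hf0
    · exact ae_restrict_of_forall_mem hA hle
  refine hmono.trans ?_
  rw [integral_finset_sum _ hgi]
  refine Finset.sum_le_sum fun i _ => ?_
  rw [integral_indicator isClosed_closedBall.measurableSet, setIntegral_const, smul_eq_mul, mul_comm]
  gcongr
  refine le_trans ?_ (hC z hz _ (by positivity))
  rw [Measure.real, hμ, Measure.restrict_apply isClosed_closedBall.measurableSet]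
  refine ENNReal.toReal_mono ((measure_mono Set.inter_subset_left).trans_lt hfinS).ne ?_
  refine measure_mono ?_
  rintro y ⟨h1, h2⟩
  exact ⟨hAS h2, h1⟩

lemma int_est (Srf : SmoothSurface) : ∃ C > 0, ∃ h₁ > 0, h₁ ≤ (1 / 4 : ℝ) ∧ ∀ z ∈ Srf.S, ∀ h : ℝ,
    0 < h → h ≤ h₁ → ∀ A : Set E3, MeasurableSet A → A ⊆ Srf.S → (∀ y ∈ A, h / 2 ≤ ‖y - z‖) →
    ∀ (f : E3 → ℝ) (B : ℝ), 0 ≤ B → (∀ y ∈ A, 0 ≤ f y) →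
      ((∀ y ∈ A, f y ≤ B / ‖y - z‖ ^ 4) → ∫ y in A, f y ∂μH[2] ≤ C * B / h ^ 2) ∧
      ((∀ y ∈ A, f y ≤ B / ‖y - z‖ ^ 2) → ∫ y in A, f y ∂μH[2] ≤ C * B * |Real.log h|) := by
  obtain ⟨C, hC0, hC⟩ := ball_measure Srf
  obtain ⟨R, hR⟩ := Srf.compact.isBounded.exists_norm_le
  set D := 2 * |R| + 1 with hD
  have hD1 : 1 ≤ D := by have := abs_nonneg R; linarith
  have hdist : ∀ z ∈ Srf.S, ∀ y ∈ Srf.S, ‖y - z‖ < D := by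
    intro z hz y hy
    refine (norm_sub_le _ _).trans_lt ?_
    have h1 := hR z hz
    have h2 := hR y hy
    have := le_abs_self R
    linarith
  refine ⟨32 * C, by positivity, min (1 / 4) (1 / (2 * D)), lt_min (by norm_num) (by positivity),
    min_le_left _ _, ?_⟩
  intro z hz h hh hh1 A hA hAS hlow f B hB hf0
  have hh4 : h ≤ 1 / 4 := hh1.trans (min_le_left _ _)
  have hhD : h * (2 * D) ≤ 1 := by
    rw [← le_div_iff₀ (by positivity)]; exact hh1.trans (min_le_right _ _)
  set l := |Real.log h| with hl
  have hl' : l = - Real.log h := abs_of_nonpos (Real.log_nonpos hh.le (by linarith))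
  have hl1 : 1 ≤ l := by
    have h2 : Real.log h ≤ Real.log (1 / 4) := Real.log_le_log hh hh4
    have h3 : Real.log (1 / 4) = - (2 * Real.log 2) := by
      rw [one_div, Real.log_inv, show (4 : ℝ) = 2 ^ 2 by norm_num, Real.log_pow]; norm_num
    have := Real.log_two_gt_d9
    linarith
  -- number of dyadic annuli
  obtain ⟨K, hK1, hK2⟩ : ∃ K : ℕ, D < 2 ^ K * (h / 2) ∧ (K : ℝ) ≤ 8 * l := by
    set x := Real.log (2 * D / h) / Real.log 2 with hx
    have hlog2 : 0 < Real.log 2 := Real.log_pos (by norm_num)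
    have hx0 : 0 ≤ x := by
      refine div_nonneg (Real.log_nonneg ?_) hlog2.le
      rw [le_div_iff₀ hh]; linarith
    refine ⟨⌊x⌋₊ + 1, ?_, ?_⟩
    · have h1 : x < (⌊x⌋₊ + 1 : ℕ) := by push_cast; exact Nat.lt_floor_add_one x
      rw [hx, div_lt_iff₀ hlog2, ← Real.log_pow] at h1
      have h2 := (Real.log_lt_log_iff (by positivity) (by positivity)).1 h1
      rw [div_lt_iff₀ hh] at h2
      linarith
    · push_cast
      have h1 := Nat.floor_le hx0
      have h2 : x ≤ 4 * l := by
        rw [hx, div_le_iff₀ hlog2]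
        have h3 : Real.log (2 * D / h) ≤ 2 * l := by
          have h4 : 2 * D / h ≤ (h⁻¹) ^ 2 := by
            rw [div_le_iff₀ hh]
            have : (h⁻¹) ^ 2 * h = h⁻¹ := by field_simp
            rw [this, ← one_div, le_div_iff₀ hh]; linarith
          have h5 := Real.log_le_log (by positivity) h4
          rw [Real.log_pow, Real.log_inv] at h5
          push_cast at h5; linarith
        have := Real.log_two_gt_d9
        nlinarith
      linarith
  have hup : ∀ y ∈ A, ‖y - z‖ < 2 ^ K * (h / 2) := fun y hy => (hdist z hz y (hAS hy)).trans hK1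
  constructor
  · intro hf
    refine (dyadic Srf C hC z hz (h / 2) (by positivity) K A hA hAS hlow hup 4 f B hB hf0 hf).trans ?_
    have h1 : ∀ i ∈ Finset.range K, B / (2 ^ i * (h / 2)) ^ 4 * (C * (2 ^ (i + 1) * (h / 2)) ^ 2)
        ≤ (16 * C * B / h ^ 2) * (1 / 2) ^ i := by
      intro i _
      have e : B / (2 ^ i * (h / 2)) ^ 4 * (C * (2 ^ (i + 1) * (h / 2)) ^ 2)
          = (16 * C * B / h ^ 2) * ((1 / 2) ^ i) ^ 2 := by
        rw [one_div, inv_pow, pow_succ]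
        field_simp
        ring
      rw [e]
      gcongr
      have h2 : ((1 : ℝ) / 2) ^ i ≤ 1 := pow_le_one₀ (by norm_num) (by norm_num)
      have h3 : 0 ≤ ((1 : ℝ) / 2) ^ i := by positivity
      nlinarith
    refine (Finset.sum_le_sum h1).trans ?_
    rw [← Finset.mul_sum]
    have h2 : ∑ i ∈ Finset.range K, ((1 : ℝ) / 2) ^ i ≤ 2 := sum_geometric_two_le K
    calc _ ≤ (16 * C * B / h ^ 2) * 2 := by gcongr
      _ = _ := by ring
  · intro hf
    refine (dyadic Srf C hC z hz (h / 2) (by positivity) K A hA hAS hlow hup 2 f B hB hf0 hf).trans ?_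
    have h1 : ∀ i ∈ Finset.range K, B / (2 ^ i * (h / 2)) ^ 2 * (C * (2 ^ (i + 1) * (h / 2)) ^ 2)
        = 4 * C * B := by
      intro i _
      rw [pow_succ]
      field_simp
      ring
    rw [Finset.sum_congr rfl h1, Finset.sum_const, Finset.card_range, nsmul_eq_mul]
    calc _ ≤ 8 * l * (4 * C * B) := by gcongr
      _ = _ := by ring



section PartE

variable {Srf : SmoothSurface} {γ₀ h : ℝ} (Tr : Triangulation Srf γ₀ h)

lemma far_lower {C₁ : ℝ} (hC1 : 1 ≤ C₁)
    (hC : ∀ y ∈ Srf.S, ∀ y' ∈ Srf.S, |⟪Srf.n y, y' - y⟫| ≤ C₁ * ‖y' - y‖ ^ 2)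
    (hh : 0 < h) (hs : 16 * C₁ * h ≤ 1) (ztil : E3) (hzt : ztil ∈ Tr.Sh)
    (t : E3 × E3 × E3) (ht : t ∈ Tr.T) (hfar : h ≤ Metric.infDist ztil (triOf t))
    (x : E3) (hx : x ∈ triOf t) : h / 2 ≤ ‖Tr.a x - Tr.a ztil‖ := by
  obtain ⟨t', ht', hzt'⟩ : ∃ t' ∈ Tr.T, ztil ∈ triOf t' := by
    simpa [Triangulation.Sh] using hzt
  have h1 := foot_sq Tr hC1 hC t' ht' ztil hzt'
  have h2 := foot_sq Tr hC1 hC t ht x hx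
  have h3 : h ≤ ‖ztil - x‖ := by
    rw [← dist_eq_norm]; exact hfar.trans (Metric.infDist_le_dist_of_mem hx)
  have h4 : ztil - x = (ztil - Tr.a ztil) - (x - Tr.a x) - (Tr.a x - Tr.a ztil) := by abel
  have h5 : ‖ztil - x‖ ≤ ‖ztil - Tr.a ztil‖ + ‖x - Tr.a x‖ + ‖Tr.a x - Tr.a ztil‖ := by
    rw [h4]
    exact (norm_sub_le _ _).trans (add_le_add_left (norm_sub_le _ _) _)
  nlinarith

lemma du_bound {C₁ C₃ : ℝ} (hC1 : 1 ≤ C₁)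
    (hC : ∀ y ∈ Srf.S, ∀ y' ∈ Srf.S, |⟪Srf.n y, y' - y⟫| ≤ C₁ * ‖y' - y‖ ^ 2)
    (hC31 : 1 ≤ C₃)
    (hC3 : ∀ y ∈ Srf.S, ‖fderiv ℝ Srf.n y‖ ≤ C₃)
    (hγ : 0 < γ₀) (hh : 0 < h) (h1 : h ≤ 1) (hs1 : 32 * C₁ / γ₀ * h ≤ 1)
    (hs2 : 32 * C₁ * C₃ * h ≤ 1)
    (t : E3 × E3 × E3) (ht : t ∈ Tr.T) (x : E3) (hx : x ∈ triOf t) (d : E3) (hd : d ∈ dirOf t) :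
    ‖d‖ ≤ 2 * ‖fderiv ℝ Tr.a x d‖ ∧
    ‖d - fderiv ℝ Tr.a x d‖ ≤ (16 * C₁ / γ₀ + 8 * C₁ * C₃) * h * ‖fderiv ℝ Tr.a x d‖ := by
  have k := a_deriv_close Tr hC1 hC hC3 hγ hh t ht x hx d hd
  set u := fderiv ℝ Tr.a x d
  have k0 : ‖d‖ ≤ ‖d - u‖ + ‖u‖ := by simpa using norm_add_le (d - u) u
  have hu : 0 ≤ ‖u‖ := norm_nonneg _
  have hd0 : 0 ≤ ‖d‖ := norm_nonneg _
  have e1 : 8 * C₁ / γ₀ * h ≤ 1 / 4 := by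
    have : 32 * C₁ / γ₀ * h = 4 * (8 * C₁ / γ₀ * h) := by ring
    linarith
  have hp : 0 ≤ C₁ * C₃ := by positivity
  have e2' : 8 * C₁ * C₃ * h ^ 2 ≤ 8 * C₁ * C₃ * h := by
    have : h ^ 2 ≤ h := by nlinarith
    have := mul_le_mul_of_nonneg_left this (by positivity : 0 ≤ 8 * C₁ * C₃)
    linarith
  have e2 : 8 * C₁ * C₃ * h ^ 2 ≤ 1 / 4 := by linarith
  have e3 := mul_le_mul_of_nonneg_right e1 hd0
  have e4 := mul_le_mul_of_nonneg_right e2 hu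
  have r1 : ‖d‖ ≤ 2 * ‖u‖ := by linarith
  refine ⟨r1, ?_⟩
  have e5 := mul_le_mul_of_nonneg_left r1 (by positivity : 0 ≤ 8 * C₁ / γ₀ * h)
  have e6 := mul_le_mul_of_nonneg_right e2' hu
  calc _ ≤ _ := k
    _ ≤ 8 * C₁ / γ₀ * h * (2 * ‖u‖) + 8 * C₁ * C₃ * h * ‖u‖ := by linarith
    _ = _ := by ring

lemma core {C₁ C₃ : ℝ} (hC1 : 1 ≤ C₁)
    (hC : ∀ y ∈ Srf.S, ∀ y' ∈ Srf.S, |⟪Srf.n y, y' - y⟫| ≤ C₁ * ‖y' - y‖ ^ 2)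
    (hC31 : 1 ≤ C₃)
    (hC3 : ∀ y ∈ Srf.S, ‖fderiv ℝ Srf.n y‖ ≤ C₃)
    (hγ : 0 < γ₀) (hh : 0 < h) (h1 : h ≤ 1) (hs1 : 32 * C₁ / γ₀ * h ≤ 1)
    (hs2 : 32 * C₁ * C₃ * h ≤ 1) (z : E3) (hz : z ∈ Srf.S)
    {r₁ Cζ : ℝ} (hCζ : 0 < Cζ) {ζ : E3 → ℝ} (hζ : IsCutoff z r₁ Cζ ζ)
    (t : E3 × E3 × E3) (ht : t ∈ Tr.T) (m : ℝ) (hm : 0 < m) (hm3 : m ≤ 3)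
    (x : E3) (hx : x ∈ triOf t)
    (hlow : ∀ p ∈ triOf t, m ≤ Srf.rfn z p ∧ Srf.rfn z p ≤ 3)
    (hlow' : ∀ p ∈ segment ℝ x (Tr.a x), m ≤ Srf.rfn z p ∧ Srf.rfn z p ≤ 3)
    (L : E3 →ₗ[ℝ] ℝ) (c : ℝ) (hv : ∀ v ∈ vertsOf t, L v + c = cutLog Srf z ζ v) :
    |L x + c - cutLog Srf z ζ (Tr.a x)| ≤
      19 * Cζ / m ^ 2 * (1 + 4 * C₁ + 4 / γ₀ + (16 * C₁ / γ₀ + 8 * C₁ * C₃)) * h ^ 2 ∧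
    ∀ d ∈ dirOf t, |L d - cutD (Srf.n z) z ζ (Tr.a x) (fderiv ℝ Tr.a x d)| ≤
      19 * Cζ / m ^ 2 * (1 + 4 * C₁ + 4 / γ₀ + (16 * C₁ / γ₀ + 8 * C₁ * C₃)) * h *
        ‖fderiv ℝ Tr.a x d‖ := by
  set M := 19 * Cζ / m ^ 2 with hM
  set K₁ := 16 * C₁ / γ₀ + 8 * C₁ * C₃ with hK₁
  have hM0 : 0 < M := by positivity
  have hK0 : 0 < K₁ := by positivity
  have hn := Srf.n_unit z hz
  set f := cutLog Srf z ζ with hf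
  set D := cutD (Srf.n z) z ζ with hD
  set y := Tr.a x with hy
  have hder : ∀ p, m ≤ Srf.rfn z p → HasFDerivAt f (D p) p := fun p hp =>
    cut_hasFDerivAt Srf z hz ζ hζ.1 p (hm.trans_le hp)
  have hDb : ∀ p, m ≤ Srf.rfn z p ∧ Srf.rfn z p ≤ 3 → ‖D p‖ ≤ M := by
    intro p hp
    rw [rfn_eq Srf z p hz] at hp
    refine (cutD_norm hζ (Srf.n z) m hm p hp.1 hp.2).trans ?_
    rw [hM, div_le_div_iff₀ hm (by positivity)]
    have : 0 < Cζ * m := by positivity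
    nlinarith
  have hDd : ∀ p q, m ≤ Srf.rfn z p ∧ Srf.rfn z p ≤ 3 → m ≤ Srf.rfn z q ∧ Srf.rfn z q ≤ 3 →
      ‖D p - D q‖ ≤ M * ‖p - q‖ := by
    intro p q hp hq
    rw [rfn_eq Srf z p hz] at hp
    rw [rfn_eq Srf z q hz] at hq
    exact cutD_diff hζ (Srf.n z) hn m hm p q hp.1 hp.2 hq.1 hq.2
  have hfoot : ‖x - y‖ ≤ 4 * C₁ * h ^ 2 := foot_sq Tr hC1 hC t ht x hx
  have hyl := hlow' y (right_mem_segment ℝ x y)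
  have hxl := hlow x hx
  -- Taylor on the triangle
  have htay : ∀ v ∈ triOf t, |f v - f x - D x (v - x)| ≤ M * h ^ 2 := by
    intro v hv'
    have := (tri_convex t).norm_image_sub_le_of_norm_hasFDerivWithin_le' (f := f) (f' := D)
      (φ := D x) (C := M * h) (x := x) (y := v)
      (fun p hp => (hder p (hlow p hp).1).hasFDerivWithinAt)
      (fun p hp => (hDd p x (hlow p hp) hxl).trans
        (mul_le_mul_of_nonneg_left (tri_dist Tr t ht p x hp hx) hM0.le)) hx hv'
    rw [Real.norm_eq_abs] at this
    refine this.trans ?_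
    have := mul_le_mul_of_nonneg_left (tri_dist Tr t ht v x hv' hx) (by positivity : 0 ≤ M * h)
    linarith
  have hg : ∀ v ∈ vertsOf t,
      |(L - (D x : E3 →ₗ[ℝ] ℝ)) v + (c - f x + D x x)| ≤ M * h ^ 2 := by
    intro v hv'
    have e := htay v (vert_mem_tri t v hv')
    have e2 := hv v hv'
    have : (L - (D x : E3 →ₗ[ℝ] ℝ)) v + (c - f x + D x x) = f v - f x - D x (v - x) := by
      rw [map_sub, ← e2]; simp; ring
    rw [this]; exact e
  have hgx := tri_bound t _ _ _ hg x hx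
  have hgx' : |L x + c - f x| ≤ M * h ^ 2 := by
    have : (L - (D x : E3 →ₗ[ℝ] ℝ)) x + (c - f x + D x x) = L x + c - f x := by
      simp; ring
    rwa [this] at hgx
  have hfxy : |f x - f y| ≤ M * (4 * C₁ * h ^ 2) := by
    have := (convex_segment x y).norm_image_sub_le_of_norm_hasFDerivWithin_le (f := f) (f' := D)
      (C := M) (x := y) (y := x)
      (fun p hp => (hder p (hlow' p hp).1).hasFDerivWithinAt)
      (fun p hp => hDb p (hlow' p hp)) (right_mem_segment ℝ x y) (left_mem_segment ℝ x y)
    rw [Real.norm_eq_abs] at this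
    exact this.trans (mul_le_mul_of_nonneg_left hfoot hM0.le)
  have hγi : 0 < 4 / γ₀ := by positivity
  constructor
  · have : L x + c - f y = (L x + c - f x) + (f x - f y) := by ring
    rw [this]
    refine (abs_add_le _ _).trans ?_
    have : 0 ≤ M * h ^ 2 * (4 / γ₀ + K₁) := by positivity
    nlinarith
  · intro d hd
    have k1 := dir_bound Tr hγ hh t ht _ _ _ hg d hd
    obtain ⟨k2, k3⟩ := du_bound Tr hC1 hC hC31 hC3 hγ hh h1 hs1 hs2 t ht x hx d hd
    set u := fderiv ℝ Tr.a x d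
    have hu : 0 ≤ ‖u‖ := norm_nonneg _
    have e : L d - D y u = (L - (D x : E3 →ₗ[ℝ] ℝ)) d + D x (d - u) + (D x - D y) u := by
      rw [map_sub]; simp
    have b1 : |(L - (D x : E3 →ₗ[ℝ] ℝ)) d| ≤ M * (4 / γ₀) * h * ‖u‖ := by
      refine k1.trans ?_
      have : 2 * (M * h ^ 2) / (γ₀ * h) = M * (2 / γ₀) * h := by field_simp
      rw [this]
      have := mul_le_mul_of_nonneg_left k2 (by positivity : 0 ≤ M * (2 / γ₀) * h)
      refine this.trans (le_of_eq ?_)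
      ring
    have b2 : |D x (d - u)| ≤ M * K₁ * h * ‖u‖ := by
      have := (D x).le_opNorm (d - u)
      rw [Real.norm_eq_abs] at this
      refine this.trans ?_
      calc ‖D x‖ * ‖d - u‖ ≤ M * (K₁ * h * ‖u‖) := by
            gcongr
            exact hDb x hxl
        _ = _ := by ring
    have b3 : |(D x - D y) u| ≤ M * (4 * C₁) * h * ‖u‖ := by
      have := (D x - D y).le_opNorm u
      rw [Real.norm_eq_abs] at this
      refine this.trans ?_
      refine mul_le_mul_of_nonneg_right ?_ hu
      refine (hDd x y hxl hyl).trans ?_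
      have h2 : h ^ 2 ≤ h := by nlinarith
      calc M * ‖x - y‖ ≤ M * (4 * C₁ * h) := by
            gcongr
            exact hfoot.trans (by gcongr)
        _ = _ := by ring
    rw [e]
    have t1 := abs_add_le ((L - (D x : E3 →ₗ[ℝ] ℝ)) d + D x (d - u)) ((D x - D y) u)
    have t2 := abs_add_le ((L - (D x : E3 →ₗ[ℝ] ℝ)) d) (D x (d - u))
    have : 0 ≤ M * h * ‖u‖ := by positivity
    nlinarith

lemma a_surj' {C₁ C₃ : ℝ} (hC1 : 1 ≤ C₁)
    (hC : ∀ y ∈ Srf.S, ∀ y' ∈ Srf.S, |⟪Srf.n y, y' - y⟫| ≤ C₁ * ‖y' - y‖ ^ 2)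
    (hC31 : 1 ≤ C₃)
    (hC3 : ∀ y ∈ Srf.S, ‖fderiv ℝ Srf.n y‖ ≤ C₃)
    (hγ : 0 < γ₀) (hh : 0 < h) (h1 : h ≤ 1) (hs1 : 32 * C₁ / γ₀ * h ≤ 1)
    (hs2 : 32 * C₁ * C₃ * h ≤ 1)
    (t : E3 × E3 × E3) (ht : t ∈ Tr.T) (x : E3) (hx : x ∈ triOf t) :
    ∀ u ∈ Srf.tangent (Tr.a x), ∃ d ∈ dirOf t, fderiv ℝ Tr.a x d = u := by
  intro u hu
  refine a_surj Tr hC1 hC t ht x hx ?_ u hu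
  intro d hd h0
  have := (du_bound Tr hC1 hC hC31 hC3 hγ hh h1 hs1 hs2 t ht x hx d hd).1
  rw [h0] at this
  simpa using this

lemma lift_eq (w : E3 → ℝ) (x : E3) (hx : x ∈ Tr.Sh) : Tr.liftS w (Tr.a x) = w x := by
  unfold Triangulation.liftS
  have hinj : Set.InjOn Tr.a Tr.Sh := Tr.a_bij.injOn
  rw [hinj.leftInvOn_invFunOn hx]

end PartE


section PartF

variable {Srf : SmoothSurface} {γ₀ h : ℝ} (Tr : Triangulation Srf γ₀ h)

lemma phi_bound (hh : 0 < h) (z : E3) (hz : z ∈ Srf.S)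
    {r₁ Cζ : ℝ} {ζ : E3 → ℝ} (hζ : IsCutoff z r₁ Cζ ζ)
    (t : E3 × E3 × E3) (ht : t ∈ Tr.T) (x : E3) (hx : x ∈ triOf t)
    (hsurj : ∀ u ∈ Srf.tangent (Tr.a x), ∃ d ∈ dirOf t, fderiv ℝ Tr.a x d = u)
    (hr : 0 < Srf.rfn z (Tr.a x))
    (L : E3 →ₗ[ℝ] ℝ) (c Q : ℝ) (hQ : 0 ≤ Q)
    (he : |L x + c - cutLog Srf z ζ (Tr.a x)| ≤ Q * h ^ 2)
    (hd : ∀ d ∈ dirOf t, |L d - cutD (Srf.n z) z ζ (Tr.a x) (fderiv ℝ Tr.a x d)| ≤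
      Q * h * ‖fderiv ℝ Tr.a x d‖)
    (w : E3 → ℝ)
    (hw : ∀ x' ∈ triOf t, w (Tr.a x') =
      Srf.rfn z (Tr.a x') ^ 2 * (L x' + c - cutLog Srf z ζ (Tr.a x'))) :
    ‖Srf.grad w (Tr.a x)‖ ≤
      2 * Srf.rfn z (Tr.a x) * (Q * h ^ 2) + Srf.rfn z (Tr.a x) ^ 2 * (Q * h) := by
  have hn := Srf.n_unit z hz
  have ha : HasFDerivAt Tr.a (fderiv ℝ Tr.a x) x :=
    (a_diff Tr x (tri_sub_N Tr t ht hx)).hasFDerivAt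
  have hf := (cut_hasFDerivAt Srf z hz ζ hζ.1 (Tr.a x) hr).comp x ha
  have hL : HasFDerivAt (fun x' => L x' + c) (LinearMap.toContinuousLinearMap L) x :=
    ((LinearMap.toContinuousLinearMap L).hasFDerivAt (x := x)).add_const c
  have hp : HasFDerivAt (fun x' => prj (Srf.n z) (Tr.a x' - z))
      ((prj (Srf.n z)).comp (fderiv ℝ Tr.a x)) x :=
    ((prj (Srf.n z)).hasFDerivAt).comp x (ha.sub_const z)
  have hp2 := hp.norm_sq
  have hφ := hp2.mul (hL.sub hf)
  refine grad_bound Tr t ht x hx hsurj w _ _ hφ.hasFDerivWithinAt ?_ _ (by positivity) ?_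
  · intro x' hx'
    rw [hw x' hx', rfn_eq Srf z _ hz]
    rfl
  · intro d hdd
    have k := hd d hdd
    set u := fderiv ℝ Tr.a x d with hu
    have hr' := rfn_eq Srf z (Tr.a x) hz
    rw [hr'] at hr ⊢
    set P := prj (Srf.n z) (Tr.a x - z) with hP
    set e := L x + c - cutLog Srf z ζ (Tr.a x) with hee
    set g := L d - cutD (Srf.n z) z ζ (Tr.a x) u with hg
    have key : |‖P‖ ^ 2 * g + e * (2 * ⟪P, prj (Srf.n z) u⟫)| ≤
        (2 * ‖P‖ * (Q * h ^ 2) + ‖P‖ ^ 2 * (Q * h)) * ‖u‖ := by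
      have i1 : |⟪P, prj (Srf.n z) u⟫| ≤ ‖P‖ * ‖u‖ :=
        (abs_real_inner_le_norm _ _).trans
          (mul_le_mul_of_nonneg_left (prj_norm_le _ _ hn) (norm_nonneg _))
      have i2 : |e * (2 * ⟪P, prj (Srf.n z) u⟫)| ≤ Q * h ^ 2 * (2 * (‖P‖ * ‖u‖)) := by
        rw [abs_mul, abs_mul, abs_two]
        gcongr
      have i3 : |‖P‖ ^ 2 * g| ≤ ‖P‖ ^ 2 * (Q * h * ‖u‖) := by
        rw [abs_mul, abs_of_nonneg (by positivity : 0 ≤ ‖P‖ ^ 2)]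
        gcongr
      refine (abs_add_le _ _).trans ?_
      linarith
    refine le_trans (le_of_eq ?_) key
    congr 1
    simp [hg, hee, hu]

lemma pointwise {C₁ C₃ c₂ : ℝ} (hC1 : 1 ≤ C₁)
    (hC : ∀ y ∈ Srf.S, ∀ y' ∈ Srf.S, |⟪Srf.n y, y' - y⟫| ≤ C₁ * ‖y' - y‖ ^ 2)
    (hC31 : 1 ≤ C₃)
    (hC3 : ∀ y ∈ Srf.S, ‖fderiv ℝ Srf.n y‖ ≤ C₃)
    (hγ : 0 < γ₀) (hh : 0 < h) (h1 : h ≤ 1) (hs1 : 32 * C₁ / γ₀ * h ≤ 1)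
    (hs2 : 32 * C₁ * C₃ * h ≤ 1) (z : E3) (hz : z ∈ Srf.S)
    {r₁ Cζ : ℝ} (hr1 : r₁ ≤ 1) (hCζ : 0 < Cζ) {ζ : E3 → ℝ} (hζ : IsCutoff z r₁ Cζ ζ)
    (hc0 : 0 < c₂) (hc1 : c₂ ≤ 1)
    (hc2 : ∀ x ∈ Srf.S, ‖x - z‖ ≤ 2 * r₁ → c₂ * ‖x - z‖ ≤ Srf.rfn z x)
    (hs3 : 16 * C₁ * h ≤ c₂) (hs4 : 12 * h ≤ r₁)
    (lI : E3 → ℝ) (hlI : Tr.IsVh lI)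
    (t : E3 × E3 × E3) (ht : t ∈ Tr.T)
    (hver : ∀ v ∈ vertsOf t, lI v = cutLog Srf z ζ v)
    (hfar : ∀ p ∈ triOf t, h / 2 ≤ ‖Tr.a p - z‖)
    (x : E3) (hx : x ∈ triOf t) (K : ℝ)
    (hK : K = 19 * Cζ * 196 / c₂ ^ 2 *
      (1 + 4 * C₁ + 4 / γ₀ + (16 * C₁ / γ₀ + 8 * C₁ * C₃))) :
    (Tr.liftS lI (Tr.a x) - cutLog Srf z ζ (Tr.a x)) ^ 2 ≤ K ^ 2 * h ^ 4 / ‖Tr.a x - z‖ ^ 4 ∧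
    (Srf.rfn z (Tr.a x) ^ 2)⁻¹ * ‖Srf.grad (fun y =>
      Srf.rfn z y ^ 2 * (Tr.liftS lI y - cutLog Srf z ζ y)) (Tr.a x)‖ ^ 2 ≤
      25 * K ^ 2 * h ^ 2 / ‖Tr.a x - z‖ ^ 2 := by
  have hK0 : 0 < K := by rw [hK]; positivity
  have hsurj := a_surj' Tr hC1 hC hC31 hC3 hγ hh h1 hs1 hs2 t ht x hx
  have hlift : ∀ p ∈ triOf t, Tr.liftS lI (Tr.a p) = lI p := fun p hp =>
    lift_eq Tr lI p (tri_sub_Sh Tr t ht hp)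
  obtain ⟨L, c, hLc⟩ := hlI.2 t ht
  have hLv : ∀ v ∈ vertsOf t, L v + c = cutLog Srf z ζ v := fun v hv => by
    rw [← hLc v (vert_mem_tri t v hv), hver v hv]
  have haS : ∀ p ∈ triOf t, Tr.a p ∈ Srf.S := fun p hp => Tr.a_mem p (tri_sub_N Tr t ht hp)
  by_cases hcase : ∃ x' ∈ triOf t, ‖Tr.a x' - z‖ ≤ 3 / 2 * r₁
  · obtain ⟨x', hx', hx'z⟩ := hcase
    have hfoot : ∀ p ∈ triOf t, ‖p - Tr.a p‖ ≤ 4 * C₁ * h ^ 2 := fun p hp =>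
      foot_sq Tr hC1 hC t ht p hp
    have hsm : 4 * C₁ * h ^ 2 ≤ c₂ * h / 4 := by nlinarith
    have hfoot' : ∀ p ∈ triOf t, ‖p - Tr.a p‖ ≤ c₂ * h / 4 := fun p hp => (hfoot p hp).trans hsm
    have hch : c₂ * h ≤ h := by nlinarith
    have hdd : ∀ p ∈ triOf t, ∀ q ∈ triOf t, ‖Tr.a p - z‖ ≤ ‖Tr.a q - z‖ + 3 * h := by
      intro p hp q hq
      have e : Tr.a p - z = (Tr.a q - z) + ((p - q) - (p - Tr.a p) + (q - Tr.a q)) := by abel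
      have n1 := norm_add_le (Tr.a q - z) ((p - q) - (p - Tr.a p) + (q - Tr.a q))
      have n2 := norm_add_le ((p - q) - (p - Tr.a p)) (q - Tr.a q)
      have n3 := norm_sub_le (p - q) (p - Tr.a p)
      have n4 := tri_dist Tr t ht p q hp hq
      have n5 := hfoot' p hp
      have n6 := hfoot' q hq
      rw [e]; linarith
    set ρ := ‖Tr.a x - z‖ with hρ
    have hρh : h / 2 ≤ ρ := hfar x hx
    have hρ0 : 0 < ρ := by linarith
    have hup : ∀ p ∈ triOf t, ‖Tr.a p - z‖ ≤ 2 * r₁ := fun p hp => by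
      have := hdd p hp x' hx'
      linarith
    have hra : ∀ p ∈ triOf t, c₂ * ‖Tr.a p - z‖ ≤ Srf.rfn z (Tr.a p) := fun p hp =>
      hc2 _ (haS p hp) (hup p hp)
    have gen : ∀ p ∈ triOf t, ∀ q, ‖q - Tr.a p‖ ≤ c₂ * h / 4 →
        c₂ * ρ / 14 ≤ Srf.rfn z q ∧ Srf.rfn z q ≤ 3 := by
      intro p hp q hq
      have i1 := rfn_lip Srf z (Tr.a p) q hz
      rw [norm_sub_rev] at i1
      have i2 := hra p hp
      have i3 := hfar p hp
      have i4 := hdd x hx p hp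
      have i5 : c₂ * ρ ≤ c₂ * (7 * ‖Tr.a p - z‖) :=
        mul_le_mul_of_nonneg_left (by linarith) hc0.le
      have i6 := mul_le_mul_of_nonneg_left i3 hc0.le
      refine ⟨by linarith, ?_⟩
      have i7 := rfn_le Srf z q hz
      have i8 : ‖q - z‖ ≤ ‖q - Tr.a p‖ + ‖Tr.a p - z‖ := norm_sub_le_norm_sub_add_norm_sub _ _ _
      have := hup p hp
      linarith
    have hm3 : c₂ * ρ / 14 ≤ 3 := by
      obtain ⟨b1, b2⟩ := gen x hx x (hfoot' x hx)
      linarith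
    obtain ⟨k1, k2⟩ := core Tr hC1 hC hC31 hC3 hγ hh h1 hs1 hs2 z hz hCζ hζ t ht (c₂ * ρ / 14)
      (by positivity) hm3 x hx (fun p hp => gen p hp p (hfoot' p hp))
      (fun p hp => gen x hx p (by
        refine le_trans ?_ (hfoot' x hx)
        rw [← dist_eq_norm, ← dist_eq_norm]
        have := (convex_closedBall (Tr.a x) (dist x (Tr.a x))).segment_subset
          (mem_closedBall.2 le_rfl) (mem_closedBall_self dist_nonneg) hp
        exact mem_closedBall.1 this)) L c hLv
    have hQ : 19 * Cζ / (c₂ * ρ / 14) ^ 2 *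
        (1 + 4 * C₁ + 4 / γ₀ + (16 * C₁ / γ₀ + 8 * C₁ * C₃)) = K / ρ ^ 2 := by
      rw [hK]; field_simp; ring
    rw [hQ] at k1 k2
    have hr0 : 0 < Srf.rfn z (Tr.a x) :=
      lt_of_lt_of_le (by positivity) (hra x hx)
    have hrρ : Srf.rfn z (Tr.a x) ≤ ρ := rfn_le Srf z _ hz
    have k3 := phi_bound Tr hh z hz hζ t ht x hx hsurj hr0 L c (K / ρ ^ 2) (by positivity) k1 k2
      (fun y => Srf.rfn z y ^ 2 * (Tr.liftS lI y - cutLog Srf z ζ y))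
      (fun p hp => by
        show Srf.rfn z (Tr.a p) ^ 2 * (Tr.liftS lI (Tr.a p) - cutLog Srf z ζ (Tr.a p)) = _
        rw [hlift p hp, hLc p hp])
    constructor
    · rw [hlift x hx, hLc x hx, ← sq_abs]
      calc _ ≤ (K / ρ ^ 2 * h ^ 2) ^ 2 := by gcongr
        _ = _ := by field_simp
    · set r := Srf.rfn z (Tr.a x) with hrdef
      calc _ ≤ (r ^ 2)⁻¹ * (2 * r * (K / ρ ^ 2 * h ^ 2) + r ^ 2 * (K / ρ ^ 2 * h)) ^ 2 := by
            gcongr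
        _ = (K * h * (2 * h + r) / ρ ^ 2) ^ 2 := by field_simp
        _ ≤ (K * h * (5 * ρ) / ρ ^ 2) ^ 2 := by
            gcongr
            linarith
        _ = _ := by field_simp; ring
  · push Not at hcase
    have hf0 : ∀ p ∈ triOf t, cutLog Srf z ζ (Tr.a p) = 0 := by
      intro p hp
      have : Tr.a p ∉ tsupport ζ := fun hmem => by
        have := mem_closedBall.1 (hζ.2.1 hmem)
        rw [dist_eq_norm] at this
        exact absurd this (not_le.2 (hcase p hp))
      simp [cutLog, image_eq_zero_of_notMem_tsupport this]
    have hL0 : ∀ p ∈ triOf t, L p + c = 0 := by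
      intro p hp
      have := tri_bound t L c 0 (fun v hv => by
        rw [hLv v hv]
        have := hf0 v (vert_mem_tri t v hv)
        rw [a_fix Tr v (Tr.verts_on t ht hv)] at this
        simp [this]) p hp
      exact abs_nonpos_iff.1 this
    have hz0 : ∀ p ∈ triOf t, Tr.liftS lI (Tr.a p) - cutLog Srf z ζ (Tr.a p) = 0 := by
      intro p hp
      rw [hlift p hp, hLc p hp, hL0 p hp, hf0 p hp, sub_zero]
    constructor
    · rw [hz0 x hx]
      have : 0 ≤ K ^ 2 * h ^ 4 / ‖Tr.a x - z‖ ^ 4 := by positivity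
      simpa using this
    · have g0 := grad_bound Tr t ht x hx hsurj
        (fun y => Srf.rfn z y ^ 2 * (Tr.liftS lI y - cutLog Srf z ζ y)) (fun _ => 0) 0
        (hasFDerivWithinAt_const _ _ _) (fun p hp => by
          show Srf.rfn z (Tr.a p) ^ 2 * (Tr.liftS lI (Tr.a p) - cutLog Srf z ζ (Tr.a p)) = _
          rw [hz0 p hp, mul_zero]) 0 le_rfl (fun d _ => by simp)
      rw [le_antisymm g0 (norm_nonneg _)]
      have : 0 ≤ 25 * K ^ 2 * h ^ 2 / ‖Tr.a x - z‖ ^ 2 := by positivity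
      simpa using this

end PartF

/-- **Interpolation estimates away from the singularity.** With `Ω₁` the union of the
triangles at distance at least `h` from `z̃₀ = (a|_{S_h})⁻¹(z₀)` and `l̃_I ∈ V_h` equal to
`l̃` at all vertices of those triangles, the lift `l̄_I` satisfies
`∫_{Ω₁^S} (l̄_I − l̃)² ≤ c h²` and `∫_{Ω₁^S} r^{-2} |∇_S(r²(l̄_I − l̃))|² ≤ c h² |log h|`. -/
theorem interpolation_estimates_away (Srf : SmoothSurface) (γ₀ : ℝ) (hγ₀ : 0 < γ₀)
    (r₁ : ℝ) (hr₁ : Srf.IsGraphRadius r₁) (Cζ : ℝ) (hCζ : 0 < Cζ) :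
    ∃ c > 0, ∃ h₀ > 0, h₀ < 1 ∧
      ∀ z₀ ∈ Srf.S, ∀ ζ : E3 → ℝ, IsCutoff z₀ r₁ Cζ ζ →
        ∀ h : ℝ, 0 < h → h ≤ h₀ →
          ∀ Tr : Triangulation Srf γ₀ h,
            ∀ ztil ∈ Tr.Sh, Tr.a ztil = z₀ →
              ∀ lI : E3 → ℝ, Tr.IsVh lI →
                (∀ t ∈ Tr.T, h ≤ Metric.infDist ztil (triOf t) →
                  ∀ vtx ∈ vertsOf t, lI vtx = cutLog Srf z₀ ζ vtx) →
                (∫ x in Tr.a '' (⋃ t ∈ Tr.T,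
                      ⋃ (_ : h ≤ Metric.infDist ztil (triOf t)), triOf t),
                    (Tr.liftS lI x - cutLog Srf z₀ ζ x) ^ 2 ∂μH[2]) ≤ c * h ^ 2 ∧
                (∫ x in Tr.a '' (⋃ t ∈ Tr.T,
                      ⋃ (_ : h ≤ Metric.infDist ztil (triOf t)), triOf t),
                    (Srf.rfn z₀ x ^ 2)⁻¹ *
                      ‖Srf.grad (fun y =>
                          Srf.rfn z₀ y ^ 2 * (Tr.liftS lI y - cutLog Srf z₀ ζ y)) x‖ ^ 2
                    ∂μH[2]) ≤ c * h ^ 2 * |Real.log h| := by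
  obtain ⟨C₁, hC1, hC⟩ := quad_normal Srf
  obtain ⟨C₃, hC31, hC3⟩ := n_deriv_bound Srf
  obtain ⟨c₂, hc0, hc1, hc2⟩ := rfn_lower Srf r₁ hr₁
  obtain ⟨CI, hCI, h₁, hh₁, hh₁4, hintg⟩ := int_est Srf
  obtain ⟨hr0, hr1, -⟩ := hr₁
  obtain ⟨K, hK⟩ : ∃ K : ℝ, K = 19 * Cζ * 196 / c₂ ^ 2 *
      (1 + 4 * C₁ + 4 / γ₀ + (16 * C₁ / γ₀ + 8 * C₁ * C₃)) := ⟨_, rfl⟩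
  have hK0 : 0 < K := by rw [hK]; positivity
  have hC10 : 0 < C₁ := by linarith
  have hC30 : 0 < C₃ := by linarith
  refine ⟨CI * (25 * K ^ 2), by positivity,
    min h₁ (min (γ₀ / (32 * C₁)) (min (1 / (32 * C₁ * C₃)) (min (c₂ / (16 * C₁)) (r₁ / 12)))),
    by positivity, lt_of_le_of_lt (min_le_left _ _) (by linarith), ?_⟩
  intro z hz ζ hζ h hh hh0 Tr ztil hzt hztz lI hlI hver
  simp only [le_min_iff] at hh0
  obtain ⟨s0, s1, s2, s3, s4⟩ := hh0
  have h1 : h ≤ 1 := by linarith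
  have hs1 : 32 * C₁ / γ₀ * h ≤ 1 := by
    rw [le_div_iff₀ (by positivity)] at s1
    rw [div_mul_eq_mul_div, div_le_one hγ₀]; linarith
  have hs2 : 32 * C₁ * C₃ * h ≤ 1 := by
    rw [le_div_iff₀ (by positivity)] at s2; linarith
  have hs3 : 16 * C₁ * h ≤ c₂ := by
    rw [le_div_iff₀ (by positivity)] at s3; linarith
  have hs4 : 12 * h ≤ r₁ := by linarith
  set A := Tr.a '' (⋃ t ∈ Tr.T, ⋃ (_ : h ≤ Metric.infDist ztil (triOf t)), triOf t) with hA
  have hAcomp : IsCompact A := by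
    refine IsCompact.image_of_continuousOn ?_ ?_
    · refine Tr.T.isCompact_biUnion fun t _ => ?_
      by_cases hc : h ≤ Metric.infDist ztil (triOf t)
      · simpa [hc] using tri_compact t
      · simp [hc]
    · refine Tr.a_smooth.continuousOn.mono ?_
      intro x hx
      simp only [Set.mem_iUnion] at hx
      obtain ⟨t, ht, _, hxt⟩ := hx
      exact tri_sub_N Tr t ht hxt
  have hfar : ∀ t ∈ Tr.T, h ≤ Metric.infDist ztil (triOf t) → ∀ p ∈ triOf t,
      h / 2 ≤ ‖Tr.a p - z‖ := by
    intro t ht hf p hp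
    rw [← hztz]
    exact far_lower Tr hC1 hC hh (hs3.trans hc1) ztil hzt t ht hf p hp
  have hAel : ∀ y ∈ A, ∃ t ∈ Tr.T, h ≤ Metric.infDist ztil (triOf t) ∧
      ∃ x ∈ triOf t, Tr.a x = y := by
    rintro y ⟨x, hx, rfl⟩
    simp only [Set.mem_iUnion] at hx
    obtain ⟨t, ht, hf, hxt⟩ := hx
    exact ⟨t, ht, hf, x, hxt, rfl⟩
  have hAS : A ⊆ Srf.S := by
    intro y hy
    obtain ⟨t, ht, _, x, hx, rfl⟩ := hAel y hy
    exact Tr.a_mem x (tri_sub_N Tr t ht hx)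
  have hAlow : ∀ y ∈ A, h / 2 ≤ ‖y - z‖ := by
    intro y hy
    obtain ⟨t, ht, hf, x, hx, rfl⟩ := hAel y hy
    exact hfar t ht hf x hx
  have hpt : ∀ y ∈ A,
      (Tr.liftS lI y - cutLog Srf z ζ y) ^ 2 ≤ K ^ 2 * h ^ 4 / ‖y - z‖ ^ 4 ∧
      (Srf.rfn z y ^ 2)⁻¹ * ‖Srf.grad (fun y =>
        Srf.rfn z y ^ 2 * (Tr.liftS lI y - cutLog Srf z ζ y)) y‖ ^ 2 ≤
        25 * K ^ 2 * h ^ 2 / ‖y - z‖ ^ 2 := by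
    intro y hy
    obtain ⟨t, ht, hf, x, hx, hxy⟩ := hAel y hy
    have := pointwise Tr hC1 hC hC31 hC3 hγ₀ hh h1 hs1 hs2 z hz hr1 hCζ hζ hc0 hc1
      (hc2 z hz) hs3 hs4 lI hlI t ht (hver t ht hf) (hfar t ht hf) x hx K hK
    rw [hxy] at this
    exact this
  constructor
  · refine ((hintg z hz h hh s0 A hAcomp.measurableSet hAS hAlow _ (K ^ 2 * h ^ 4) (by positivity)
      (fun y _ => by positivity)).1 (fun y hy => (hpt y hy).1)).trans ?_
    have e : CI * (K ^ 2 * h ^ 4) / h ^ 2 = CI * K ^ 2 * h ^ 2 := by field_simp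
    rw [e]
    have : 0 ≤ CI * K ^ 2 * h ^ 2 := by positivity
    linarith
  · refine ((hintg z hz h hh s0 A hAcomp.measurableSet hAS hAlow _ (25 * K ^ 2 * h ^ 2)
      (by positivity) (fun y _ => by positivity)).2 (fun y hy => (hpt y hy).2)).trans ?_
    exact le_of_eq (by ring)

end
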